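/- arXiv:0904.3957 — 3 statements merged into one kernel-verified Lean document; each statement's English description precedes it below -/
import Mathlib

section
/- There exists a ℂ[t]-algebra R which is flat as a ℂ[t]-module, such that R/(t−c)R is isomorphic as a ℂ-algebra to ℂ[M_{n,m}] for every nonzero c ∈ ℂ, and R/tR is isomorphic as a ℂ-algebra to the Hibi algebra H_{D(n,m)} over the distributive lattice D(n,m); i.e., ℂ[M_{n,m}] is a flat deformation of H_{D(n,m)}. -/
noncomputable section

/-- One-line tableau predicate: `isTab n m I J` says `[I:J]` is a one-line tableau in `D(n,m)`,
i.e. `I ⊆ {1,…,n}` and `J ⊆ {1,…,m}` are strictly increasing sequences of the same (positive) length. -/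
def isTab (n m : ℕ) (I J : List ℕ) : Prop :=
  I.length = J.length ∧ I ≠ [] ∧ I.Chain' (· < ·) ∧ J.Chain' (· < ·) ∧
    (∀ x ∈ I, 1 ≤ x ∧ x ≤ n) ∧ ∀ x ∈ J, 1 ≤ x ∧ x ≤ m

/-- The tableau order `A ⪯ B` on one-line tableaux. -/
def tleq (A B : List ℕ × List ℕ) : Prop :=
  B.1.length ≤ A.1.length ∧
    ∀ r < B.1.length, A.1.getD r 0 ≤ B.1.getD r 0 ∧ A.2.getD r 0 ≤ B.2.getD r 0

/-- The map ξ : `ξ([I:J]) = [j₁,…,jₕ, m+u₁,…,m+u_{n−h}]` where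
`{n+1−u₁,…,n+1−u_{n−h}}` is the complement of `I` in `{1,…,n}`. -/
def xi (n m : ℕ) (I J : List ℕ) : List ℕ :=
  J ++ ((((List.range n).map (· + 1)).filter fun c => decide (c ∉ I)).reverse.map
      fun c => m + (n + 1 - c))

/-- The top element `[m+1, …, m+n]`. -/
def topL (n m : ℕ) : List ℕ := (List.range n).map fun r => m + r + 1

def xiInvI (n m : ℕ) (K : List ℕ) : List ℕ :=
  ((List.range n).map (· + 1)).filter fun i => decide (m + (n + 1 - i) ∉ K)

def xiInvJ (m : ℕ) (K : List ℕ) : List ℕ := K.filter fun x => decide (x ≤ m)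

/-- The meet `A ∧ B` in the distributive lattice `D(n,m)`, computed by transporting the
entrywise minimum through the order isomorphism ξ. -/
def tabMeet (n m : ℕ) (A B : List ℕ × List ℕ) : List ℕ × List ℕ :=
  (xiInvI n m (List.zipWith min (xi n m A.1 A.2) (xi n m B.1 B.2)),
    xiInvJ m (List.zipWith min (xi n m A.1 A.2) (xi n m B.1 B.2)))

/-- The join `A ∨ B` in the distributive lattice `D(n,m)`. -/
def tabJoin (n m : ℕ) (A B : List ℕ × List ℕ) : List ℕ × List ℕ :=
  (xiInvI n m (List.zipWith max (xi n m A.1 A.2) (xi n m B.1 B.2)),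
    xiInvJ m (List.zipWith max (xi n m A.1 A.2) (xi n m B.1 B.2)))

open Classical in
/-- The variable `z_t` of the Hibi algebra when `t` belongs to the lattice, else `0`. -/
def hVar (P : List ℕ × List ℕ → Prop) (t : List ℕ × List ℕ) : MvPolynomial {s // P s} ℂ :=
  if h : P t then MvPolynomial.X ⟨t, h⟩ else 0

/-- The Hibi ideal `(z_x z_y − z_{x∧y} z_{x∨y})` for the lattice `{s // P s}` with meet `mt`
and join `jn`; the Hibi algebra over the lattice is the corresponding quotient. -/
def hibiIdeal (P : List ℕ × List ℕ → Prop)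
    (mt jn : List ℕ × List ℕ → List ℕ × List ℕ → List ℕ × List ℕ) :
    Ideal (MvPolynomial {s // P s} ℂ) :=
  Ideal.span {f | ∃ x y : {s // P s},
    f = MvPolynomial.X x * MvPolynomial.X y - hVar P (mt x.1 y.1) * hVar P (jn x.1 y.1)}

/-- `FlatDeform S₁ S₀` : a flat ℂ[t]-algebra with general fiber `S₁` (at each `t = c ≠ 0`)
and special fiber `S₀` (at `t = 0`). -/
structure FlatDeform (S₁ S₀ : Type) [CommRing S₁] [Algebra ℂ S₁] [CommRing S₀]
    [Algebra ℂ S₀] : Type 1 where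
  R : Type
  [cring : CommRing R]
  [algC : Algebra ℂ R]
  [algP : Algebra (Polynomial ℂ) R]
  [tower : IsScalarTower ℂ (Polynomial ℂ) R]
  flat : Module.Flat (Polynomial ℂ) R
  generic : ∀ c : ℂ, c ≠ 0 →
    Nonempty ((R ⧸ Ideal.span {(algebraMap (Polynomial ℂ) R) (Polynomial.X - Polynomial.C c)})
      ≃ₐ[ℂ] S₁)
  special : Nonempty ((R ⧸ Ideal.span {(algebraMap (Polynomial ℂ) R) Polynomial.X}) ≃ₐ[ℂ] S₀)

/-- Two quotients by kernels of algebra maps with the same range are isomorphic. -/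
theorem nonempty_quotient_algEquiv_of_range_eq {P Q B : Type*} [CommRing P] [CommRing Q]
    [CommRing B] [Algebra ℂ P] [Algebra ℂ Q] [Algebra ℂ B] (f : P →ₐ[ℂ] B) (g : Q →ₐ[ℂ] B)
    (I : Ideal P) (J : Ideal Q) (hI : RingHom.ker f = I) (hJ : RingHom.ker g = J)
    (h : f.range = g.range) : Nonempty ((P ⧸ I) ≃ₐ[ℂ] (Q ⧸ J)) := by
  subst hI hJ
  exact ⟨(Ideal.quotientKerAlgEquivOfSurjective f.rangeRestrict_surjective |>.symm.trans
    (Ideal.quotientEquivAlgOfEq ℂ (by ext; simp [RingHom.mem_ker, Subtype.ext_iff]))).symm.trans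
    ((Subalgebra.equivOfEq _ _ h).trans
    (Ideal.quotientKerAlgEquivOfSurjective g.rangeRestrict_surjective |>.symm.trans
    (Ideal.quotientEquivAlgOfEq ℂ (by ext; simp [RingHom.mem_ker, Subtype.ext_iff]))))⟩

/-- Specialization of the deformation parameter at `c`. -/
def specialize (τ : Type) (c : ℂ) : MvPolynomial τ (Polynomial ℂ) →ₐ[ℂ] MvPolynomial τ ℂ :=
  MvPolynomial.mapAlgHom (Polynomial.aeval c)

theorem specialize_C {τ : Type} (c : ℂ) (q : Polynomial ℂ) :
    specialize τ c (MvPolynomial.C q) = MvPolynomial.C (q.eval c) := by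
  simp [specialize]

theorem specialize_smul {τ : Type} (c : ℂ) (q : Polynomial ℂ)
    (f : MvPolynomial τ (Polynomial ℂ)) :
    specialize τ c (q • f) = q.eval c • specialize τ c f := by
  rw [MvPolynomial.smul_eq_C_mul, map_mul, specialize_C, MvPolynomial.smul_eq_C_mul]

theorem specialize_X {τ : Type} (c : ℂ) (i : τ) :
    specialize τ c (MvPolynomial.X i) = MvPolynomial.X i := by
  simp [specialize]

theorem specialize_surjective (τ : Type) (c : ℂ) : Function.Surjective (specialize τ c) := by
  apply MvPolynomial.map_surjective
  intro z
  exact ⟨Polynomial.C z, by simp⟩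

theorem specialize_eq_zero_iff {τ : Type} (c : ℂ) (f : MvPolynomial τ (Polynomial ℂ)) :
    specialize τ c f = 0 ↔ ∃ g, f = (Polynomial.X - Polynomial.C c) • g := by
  constructor
  · intro h
    have : MvPolynomial.C (Polynomial.X - Polynomial.C c) ∣ f := by
      rw [MvPolynomial.C_dvd_iff_dvd_coeff]
      intro i
      rw [Polynomial.dvd_iff_isRoot, Polynomial.IsRoot]
      have h2 := congrArg (MvPolynomial.coeff i) h
      simpa [specialize, MvPolynomial.coeff_map, Polynomial.aeval_def,
        Polynomial.eval₂_eq_eval_map] using h2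
    obtain ⟨g, rfl⟩ := this
    exact ⟨g, by rw [MvPolynomial.smul_eq_C_mul]⟩
  · rintro ⟨g, rfl⟩
    rw [specialize_smul]
    simp

section Saturation

open Polynomial

variable {A B A₀ B₀ : Type} [CommRing A] [CommRing B] [CommRing A₀] [CommRing B₀]
  [Algebra ℂ[X] A] [Algebra ℂ[X] B] [Algebra ℂ B] [Algebra ℂ A₀] [Algebra ℂ B₀]
  [IsScalarTower ℂ ℂ[X] B]

/-- The `t`-saturation of the range of `ψ`. -/
def saturation (ψ : A →ₐ[ℂ[X]] B) : Subalgebra ℂ[X] B where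
  carrier := {g | ∃ (k : ℕ) (a : A), ψ a = (X : ℂ[X]) ^ k • g}
  mul_mem' := by
    rintro f g ⟨k, a, ha⟩ ⟨l, b, hb⟩
    exact ⟨k + l, a * b, by rw [map_mul, ha, hb, smul_mul_smul_comm, pow_add]⟩
  add_mem' := by
    rintro f g ⟨k, a, ha⟩ ⟨l, b, hb⟩
    refine ⟨k + l, (X : ℂ[X]) ^ l • a + (X : ℂ[X]) ^ k • b, ?_⟩
    rw [map_add, map_smul, map_smul, ha, hb, smul_add, smul_smul, smul_smul, pow_add,
      mul_comm (X ^ l)]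
  algebraMap_mem' r := ⟨0, algebraMap _ _ r, by simp⟩

/-- A specialization map on `B`, restricted to the saturation. -/
def saturationSpecialize (ψ : A →ₐ[ℂ[X]] B) (ε : B →ₐ[ℂ] B₀) : saturation ψ →ₐ[ℂ] B₀ :=
  ε.comp ((saturation ψ).val.restrictScalars ℂ)

/-- `ε` is a specialization at `t = c`: its kernel is generated by `t - c`. -/
def IsSpecialization (ε : B →ₐ[ℂ] B₀) (c : ℂ) : Prop :=
  ∀ f, ε f = 0 ↔ ∃ g, f = ((X : ℂ[X]) - C c) • g

theorem IsSpecialization.map_smul {ε : B →ₐ[ℂ] B₀} {c : ℂ} (hε : IsSpecialization ε c)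
    (q : ℂ[X]) (f : B) : ε (q • f) = q.eval c • ε f := by
  obtain ⟨r, hr⟩ := dvd_iff_isRoot.2 (show IsRoot (q - C (q.eval c)) c by simp)
  have h1 : ε ((q - C (q.eval c)) • f) = 0 := (hε _).2 ⟨r • f, by rw [hr, mul_smul]⟩
  rw [sub_smul, map_sub, sub_eq_zero] at h1
  rw [h1, ← Polynomial.algebraMap_eq, algebraMap_smul, _root_.map_smul]

theorem ker_saturationSpecialize_zero (ψ : A →ₐ[ℂ[X]] B) {ε : B →ₐ[ℂ] B₀}
    (hε : IsSpecialization ε 0) :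
    RingHom.ker (saturationSpecialize ψ ε) = Ideal.span {algebraMap ℂ[X] (saturation ψ) X} := by
  ext ⟨g, hg⟩
  rw [Ideal.mem_span_singleton', RingHom.mem_ker]
  change ε g = 0 ↔ _
  rw [hε]
  constructor
  · rintro ⟨h, rfl⟩
    obtain ⟨k, a, ha⟩ := hg
    refine ⟨⟨h, k + 1, a, ?_⟩, ?_⟩
    · rw [ha, smul_smul, pow_succ]; simp
    · ext1
      change h * algebraMap ℂ[X] B X = (X - C 0) • h
      rw [Algebra.smul_def, mul_comm]; simp
  · rintro ⟨⟨h, hh⟩, e⟩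
    refine ⟨h, ?_⟩
    have := congrArg Subtype.val e
    change h * algebraMap ℂ[X] B X = g at this
    rw [← this, Algebra.smul_def, mul_comm]; simp

variable [Algebra ℂ A] [Module.IsTorsionFree ℂ[X] B]

theorem ker_saturationSpecialize (ψ : A →ₐ[ℂ[X]] B) {c : ℂ} {δ : A →ₐ[ℂ] A₀} {ε : B →ₐ[ℂ] B₀}
    (hδ : IsSpecialization δ c) (hε : IsSpecialization ε c) (hψ : ∀ a, ε (ψ a) = 0 → δ a = 0) :
    RingHom.ker (saturationSpecialize ψ ε) =
      Ideal.span {algebraMap ℂ[X] (saturation ψ) (X - C c)} := by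
  ext ⟨g, hg⟩
  rw [Ideal.mem_span_singleton', RingHom.mem_ker]
  change ε g = 0 ↔ _
  constructor
  · intro h0
    obtain ⟨h, rfl⟩ := (hε g).1 h0
    obtain ⟨k, a, ha⟩ := hg
    obtain ⟨b, rfl⟩ := (hδ a).1 (hψ a (by rw [ha, hε.map_smul, h0, smul_zero]))
    refine ⟨⟨h, k, b, ?_⟩, ?_⟩
    · rw [map_smul, smul_comm] at ha
      exact smul_right_injective _ (X_sub_C_ne_zero c) ha
    · ext1
      change h * algebraMap ℂ[X] B (X - C c) = (X - C c) • h
      rw [Algebra.smul_def, mul_comm]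
  · rintro ⟨⟨h, hh⟩, e⟩
    have := congrArg Subtype.val e
    change h * algebraMap ℂ[X] B (X - C c) = g at this
    rw [hε]
    exact ⟨h, by rw [← this, Algebra.smul_def, mul_comm]⟩

variable [IsScalarTower ℂ ℂ[X] A]

theorem nonempty_saturation_fibre (ψ : A →ₐ[ℂ[X]] B) {c : ℂ} (hc : c ≠ 0)
    {δ : A →ₐ[ℂ] A₀} {ε : B →ₐ[ℂ] B₀}
    (hδ : IsSpecialization δ c) (hε : IsSpecialization ε c) (hsurj : Function.Surjective δ)
    (hψ : ∀ a, ε (ψ a) = 0 → δ a = 0) :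
    Nonempty ((saturation ψ ⧸ Ideal.span {algebraMap ℂ[X] (saturation ψ) (X - C c)}) ≃ₐ[ℂ]
      A₀) := by
  have hker : RingHom.ker (ε.comp (ψ.restrictScalars ℂ)) = RingHom.ker δ := by
    ext a
    refine ⟨hψ a, fun ha => ?_⟩
    obtain ⟨b, rfl⟩ := (hδ a).1 ha
    exact (hε _).2 ⟨ψ b, by simp⟩
  have hrange : (saturationSpecialize ψ ε).range = (ε.comp (ψ.restrictScalars ℂ)).range := by
    apply le_antisymm
    · rintro _ ⟨⟨g, k, a, ha⟩, rfl⟩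
      refine ⟨c⁻¹ ^ k • a, ?_⟩
      change ε.comp (ψ.restrictScalars ℂ) _ = ε g
      rw [map_smul]
      change c⁻¹ ^ k • ε (ψ a) = ε g
      rw [ha, hε.map_smul, smul_smul]
      simp [hc]
    · rintro _ ⟨a, rfl⟩
      exact ⟨⟨ψ a, 0, a, by simp⟩, rfl⟩
  obtain ⟨f⟩ := nonempty_quotient_algEquiv_of_range_eq (saturationSpecialize ψ ε)
    (ε.comp (ψ.restrictScalars ℂ)) _ _ (ker_saturationSpecialize ψ hδ hε hψ) hker hrange
  exact ⟨f.trans (Ideal.quotientKerAlgEquivOfSurjective hsurj)⟩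

/-- If elements specialize at `0` to linearly independent elements, a combination divisible by
`t ^ k` has coefficients divisible by `t ^ k`. -/
theorem exists_eq_sum_of_sum_eq_pow_smul {ι : Type}
    {ε : B →ₐ[ℂ] B₀} (hε : IsSpecialization ε 0)
    (g : ι → B) (hg : LinearIndependent ℂ fun i => ε (g i))
    (s : Finset ι) (k : ℕ) (d : ι → ℂ[X]) (h : B)
    (hd : ∑ i ∈ s, d i • g i = (X : ℂ[X]) ^ k • h) :
    ∃ d' : ι → ℂ[X], h = ∑ i ∈ s, d' i • g i := by
  induction k generalizing d with
  | zero => exact ⟨d, by simp [hd]⟩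
  | succ k ih =>
    have h0 := congrArg ε hd
    rw [hε.map_smul, map_sum] at h0
    simp only [hε.map_smul, eval_pow, eval_X, ne_eq, Nat.succ_ne_zero,
      not_false_eq_true, zero_pow, zero_smul] at h0
    have hz : ∀ i ∈ s, (d i).eval 0 = 0 :=
      linearIndependent_iff'.1 hg s (fun i => (d i).eval 0) h0
    have hx : ∀ i, ∃ q, i ∈ s → d i = X * q := by
      intro i
      by_cases hi : i ∈ s
      · have : X ∣ d i := by
          rw [X_dvd_iff, coeff_zero_eq_eval_zero]
          exact hz i hi
        obtain ⟨q, hq⟩ := this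
        exact ⟨q, fun _ => hq⟩
      · exact ⟨0, fun h => absurd h hi⟩
    choose q hq using hx
    apply ih q
    have hXX : (X : ℂ[X]) ≠ 0 := X_ne_zero
    apply smul_right_injective _ hXX
    change (X : ℂ[X]) • _ = (X : ℂ[X]) • _
    rw [smul_smul, ← pow_succ', ← hd, Finset.smul_sum]
    exact Finset.sum_congr rfl fun i hi => by rw [smul_smul, hq i hi]

/-- A Rees-type degeneration: if `A` is spanned by elements `p i` whose images under `ψ` have
linearly independent leading forms in `t`, then `A₀` deforms to the algebra they span. -/
theorem nonempty_flatDeform {ι S : Type} [CommRing S] [Algebra ℂ S]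
    (ψ : A →ₐ[ℂ[X]] B) (δ : ℂ → A →ₐ[ℂ] A₀) (ε : ℂ → B →ₐ[ℂ] B₀)
    (hδ : ∀ c, IsSpecialization (δ c) c) (hε : ∀ c, IsSpecialization (ε c) c)
    (hsurj : ∀ c, Function.Surjective (δ c))
    (hψ : ∀ c : ℂ, c ≠ 0 → ∀ a, ε c (ψ a) = 0 → δ c a = 0)
    (p : ι → A) (hp : Submodule.span ℂ[X] (Set.range p) = ⊤)
    (w : ι → ℕ) (g : ι → B) (hpg : ∀ i, ψ (p i) = (X : ℂ[X]) ^ w i • g i)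
    (hg : LinearIndependent ℂ fun i => ε 0 (g i))
    (η : S →ₐ[ℂ] B₀) (I : Ideal S) (hker : RingHom.ker η = I)
    (hrange : Subalgebra.toSubmodule η.range =
      Submodule.span ℂ (Set.range fun i => ε 0 (g i))) :
    Nonempty (FlatDeform A₀ (S ⧸ I)) := by
  have hr : (saturationSpecialize ψ (ε 0)).range = η.range := by
    apply Subalgebra.toSubmodule_injective
    rw [hrange]
    apply le_antisymm
    · rintro _ ⟨⟨h, k, a, ha⟩, rfl⟩
      change ε 0 h ∈ _
      have hmem : a ∈ Submodule.span ℂ[X] (Set.range p) := hp ▸ Submodule.mem_top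
      obtain ⟨c, hc⟩ := Finsupp.mem_span_range_iff_exists_finsupp.1 hmem
      obtain ⟨d', rfl⟩ := exists_eq_sum_of_sum_eq_pow_smul (hε 0) g hg c.support k
        (fun i => c i * X ^ w i) h (by
          rw [← ha, ← hc, Finsupp.sum, map_sum]
          exact Finset.sum_congr rfl fun i _ => by rw [map_smul, hpg, smul_smul])
      rw [map_sum]
      refine Submodule.sum_mem _ fun i _ => ?_
      rw [(hε 0).map_smul]
      exact Submodule.smul_mem _ _ (Submodule.subset_span ⟨i, rfl⟩)
    · rw [Submodule.span_le]
      rintro _ ⟨i, rfl⟩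
      exact ⟨⟨g i, w i, p i, hpg i⟩, rfl⟩
  have htf : Module.IsTorsionFree ℂ[X] (saturation ψ) := inferInstance
  exact ⟨{
    R := saturation ψ
    flat := inferInstance
    generic := fun c hc =>
      nonempty_saturation_fibre ψ hc (hδ c) (hε c) (hsurj c) (hψ c hc)
    special := nonempty_quotient_algEquiv_of_range_eq _ η _ I
      (ker_saturationSpecialize_zero ψ (hε 0)) hker hr }⟩

end Saturation

/-- Any two members of the multiset are comparable through `κ`. -/
def IsChainMultiset {T : Type} {n : ℕ} (κ : T → Fin n → ℕ) (s : Multiset T) : Prop :=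
  ∀ x ∈ s, ∀ y ∈ s, κ x ≤ κ y ∨ κ y ≤ κ x

/-- Straightening: products can be rewritten through products over chains as soon as each
incomparable pair can be rewritten with a bounded potential `Q` increasing. -/
theorem prod_mem_span_chain {k C T : Type} {n : ℕ} [CommRing k] [CommRing C] [Algebra k C]
    (κ : T → Fin n → ℕ) (Q : T → ℕ) (M : ℕ) (hM : ∀ x, Q x ≤ M) (p : T → C)
    (h : ∀ x y, ¬ κ x ≤ κ y → ¬ κ y ≤ κ x → p x * p y ∈
      Submodule.span k {z | ∃ u v, Q x + Q y < Q u + Q v ∧ z = p u * p v}) (s : Multiset T) :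
    (s.map p).prod ∈
      Submodule.span k (Set.range fun s : {s // IsChainMultiset κ s} => (s.1.map p).prod) := by
  have hb : ∀ s : Multiset T, (s.map Q).sum ≤ s.card * M := fun s => by
    simpa using Multiset.sum_le_card_nsmul (s.map Q) M (by simp; intro a _; exact hM a)
  induction hN : s.card * M - (s.map Q).sum using Nat.strong_induction_on generalizing s with
  | _ N ih =>
  by_cases hs : IsChainMultiset κ s
  · exact Submodule.subset_span ⟨⟨s, hs⟩, rfl⟩
  simp only [IsChainMultiset, not_forall, not_or] at hs
  obtain ⟨x, hx, y, hy, hxy, hyx⟩ := hs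
  obtain ⟨t, rfl⟩ := Multiset.exists_cons_of_mem hx
  have hne : y ≠ x := by rintro rfl; exact hxy le_rfl
  obtain ⟨t, rfl⟩ := Multiset.exists_cons_of_mem ((Multiset.mem_cons.1 hy).resolve_left hne)
  rw [Multiset.map_cons, Multiset.map_cons, Multiset.prod_cons, Multiset.prod_cons, ← mul_assoc]
  refine Submodule.span_induction (p := fun z _ => z * (t.map p).prod ∈ _) ?_ ?_ ?_ ?_
    (h x y hxy hyx)
  · rintro _ ⟨u, v, huv, rfl⟩
    have := ih _ ?_ (u ::ₘ v ::ₘ t) rfl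
    · simpa [mul_assoc] using this
    · have h1 := hb (u ::ₘ v ::ₘ t)
      simp only [Multiset.map_cons, Multiset.sum_cons, Multiset.card_cons] at h1 hN ⊢
      omega
  · simp
  · intro a b _ _ ha hb
    rw [add_mul]
    exact Submodule.add_mem _ ha hb
  · intro a b _ hb
    rw [smul_mul_assoc]
    exact Submodule.smul_mem _ _ hb

theorem adjoin_range_le_span_multiset_prod {k C T : Type} [CommRing k] [CommRing C] [Algebra k C]
    (p : T → C) : Subalgebra.toSubmodule (Algebra.adjoin k (Set.range p)) ≤
      Submodule.span k (Set.range fun s : Multiset T => (s.map p).prod) := by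
  rw [Algebra.adjoin_eq_span]
  apply Submodule.span_mono
  intro z hz
  obtain ⟨l, hl, rfl⟩ := Submonoid.exists_multiset_of_mem_closure hz
  induction l using Multiset.induction_on with
  | empty => exact ⟨0, by simp⟩
  | cons a l ih =>
    obtain ⟨s, hs⟩ := ih (fun b hb => hl b (Multiset.mem_cons_of_mem hb))
      (Submonoid.multiset_prod_mem _ _ fun b hb =>
        Submonoid.subset_closure (hl b (Multiset.mem_cons_of_mem hb)))
    obtain ⟨x, rfl⟩ := hl a (Multiset.mem_cons_self _ _)
    exact ⟨x ::ₘ s, by simpa using congrArg (p x * ·) hs⟩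

theorem exists_least_of_isChainMultiset {T : Type} {n : ℕ} {κ : T → Fin n → ℕ} {s : Multiset T}
    (hs : IsChainMultiset κ s) (h0 : s ≠ 0) : ∃ x ∈ s, ∀ y ∈ s, κ x ≤ κ y := by
  classical
  obtain ⟨a, ha⟩ := Multiset.exists_mem_of_ne_zero h0
  obtain ⟨x, hx, hmin⟩ := s.toFinset.exists_min_image (fun x => ∑ r, κ x r)
    ⟨a, Multiset.mem_toFinset.2 ha⟩
  rw [Multiset.mem_toFinset] at hx
  refine ⟨x, hx, fun y hy => (hs x hx y hy).elim id fun hle => ?_⟩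
  by_contra hcon
  obtain ⟨r, hr⟩ := not_forall.1 hcon
  have := Finset.sum_lt_sum (fun i (_ : i ∈ Finset.univ) => hle i)
    ⟨r, Finset.mem_univ r, not_le.1 hr⟩
  exact absurd (hmin y (Multiset.mem_toFinset.2 hy)) (not_le.2 this)

theorem IsChainMultiset.eq_of_map_eq {T : Type} {n : ℕ} {κ : T → Fin n → ℕ}
    (hκ : Function.Injective κ) {s s' : Multiset T} (hs : IsChainMultiset κ s)
    (hs' : IsChainMultiset κ s') (hcard : s.card = s'.card)
    (h : ∀ r, s.map (κ · r) = s'.map (κ · r)) : s = s' := by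
  induction hN : s.card generalizing s s' with
  | zero => rw [Multiset.card_eq_zero.1 hN, Multiset.card_eq_zero.1 (hcard.symm.trans hN)]
  | succ N ih =>
    obtain ⟨x, hx, hxm⟩ := exists_least_of_isChainMultiset hs
      (fun h0 => by simp [h0] at hN)
    obtain ⟨y, hy, hym⟩ := exists_least_of_isChainMultiset hs'
      (fun h0 => by rw [hcard, h0] at hN; simp at hN)
    have hxy : x = y := hκ <| funext fun r => by
      have h1 : κ x r ∈ s'.map (κ · r) := h r ▸ Multiset.mem_map_of_mem (κ · r) hx
      have h2 : κ y r ∈ s.map (κ · r) := h r ▸ Multiset.mem_map_of_mem (κ · r) hy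
      obtain ⟨z, hz, hzr⟩ := Multiset.mem_map.1 h1
      obtain ⟨z', hz', hzr'⟩ := Multiset.mem_map.1 h2
      exact le_antisymm (hzr' ▸ hxm z' hz' r) (hzr ▸ hym z hz r)
    subst hxy
    obtain ⟨t, rfl⟩ := Multiset.exists_cons_of_mem hx
    obtain ⟨t', rfl⟩ := Multiset.exists_cons_of_mem hy
    rw [ih (s := t) (s' := t')]
    · exact fun a ha b hb => hs a (Multiset.mem_cons_of_mem ha) b (Multiset.mem_cons_of_mem hb)
    · exact fun a ha b hb => hs' a (Multiset.mem_cons_of_mem ha) b (Multiset.mem_cons_of_mem hb)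
    · simpa using hcard
    · intro r; simpa using h r
    · simpa using hN

/-- The exponent of the diagonal term of the maximal minor with columns `K`, where the entry of
row `r` in column `m + 1 + r` is `1`. -/
def diagExponent (m : ℕ) {n : ℕ} (K : Fin n → ℕ) : Fin n × ℕ →₀ ℕ :=
  ∑ r : Fin n, if K r < m + 1 + r then Finsupp.single (r, K r) 1 else 0

theorem diagExponent_apply (m : ℕ) {n : ℕ} (K : Fin n → ℕ) (r : Fin n) (c : ℕ) :
    diagExponent m K (r, c) = if c < m + 1 + r ∧ K r = c then 1 else 0 := by
  rw [diagExponent, Finsupp.finsetSum_apply, Finset.sum_eq_single r]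
  · by_cases hc : K r = c
    · subst hc
      split_ifs <;> simp_all
    · split_ifs <;> simp_all
  · intro b _ hb
    split_ifs <;> simp [hb]
  · simp

theorem sum_diagExponent_apply {T : Type} (m : ℕ) {n : ℕ} (κ : T → Fin n → ℕ) (s : Multiset T)
    (r : Fin n) (c : ℕ) (hc : c < m + 1 + r) :
    (s.map fun x => diagExponent m (κ x)).sum (r, c) = (s.map (κ · r)).count c := by
  induction s using Multiset.induction_on with
  | empty => simp
  | cons a s ih =>
    simp only [Multiset.map_cons, Multiset.sum_cons, Finsupp.add_apply, ih, diagExponent_apply,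
      Multiset.count_cons, hc, true_and, eq_comm (a := c)]
    ring

theorem IsChainMultiset.eq_of_sum_diagExponent_eq {T : Type} {m n : ℕ} (hn : 0 < n)
    {κ : T → Fin n → ℕ} (hκ : Function.Injective κ) (h0 : ∀ x, κ x ⟨0, hn⟩ ≤ m)
    (hle : ∀ x r, κ x r ≤ m + 1 + r) {s s' : Multiset T} (hs : IsChainMultiset κ s)
    (hs' : IsChainMultiset κ s')
    (h : (s.map fun x => diagExponent m (κ x)).sum =
      (s'.map fun x => diagExponent m (κ x)).sum) : s = s' := by
  have hcount : ∀ (r : Fin n) (c : ℕ), c < m + 1 + r →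
      (s.map (κ · r)).count c = (s'.map (κ · r)).count c := fun r c hc => by
    rw [← sum_diagExponent_apply m κ s r c hc, h, sum_diagExponent_apply m κ s' r c hc]
  have hsum0 : ∀ s : Multiset T,
      ∑ c ∈ Finset.range (m + 1), (s.map (κ · ⟨0, hn⟩)).count c = s.card := fun s => by
    rw [Multiset.sum_count_eq_card, Multiset.card_map]
    intro a ha
    obtain ⟨x, _, rfl⟩ := Multiset.mem_map.1 ha
    exact Finset.mem_range.2 (Nat.lt_succ_of_le (h0 x))
  have hsum : ∀ (s : Multiset T) (r : Fin n),
      ∑ c ∈ Finset.range (m + 1 + r + 1), (s.map (κ · r)).count c = s.card := fun s r => by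
    rw [Multiset.sum_count_eq_card, Multiset.card_map]
    intro a ha
    obtain ⟨x, _, rfl⟩ := Multiset.mem_map.1 ha
    exact Finset.mem_range.2 (Nat.lt_succ_of_le (hle x r))
  have hcard : s.card = s'.card := by
    rw [← hsum0 s, ← hsum0 s']
    exact Finset.sum_congr rfl fun c hc => hcount _ c (by simpa using hc)
  refine IsChainMultiset.eq_of_map_eq hκ hs hs' hcard fun r => Multiset.ext.2 fun c => ?_
  rcases lt_trichotomy c (m + 1 + r) with hc | rfl | hc
  · exact hcount r c hc
  · have h1 := hsum s r
    rw [hcard, ← hsum s' r, Finset.sum_range_succ, Finset.sum_range_succ,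
      Finset.sum_congr rfl fun c hc => hcount r c (by simpa using hc)] at h1
    exact Nat.add_left_cancel h1
  · rw [Multiset.count_eq_zero.2, Multiset.count_eq_zero.2]
    all_goals
      intro hmem
      obtain ⟨x, _, rfl⟩ := Multiset.mem_map.1 hmem
      exact absurd (hle x r) (not_le.2 hc)

/-- The monomial map of the Hibi algebra. -/
def diagHom {T : Type} (m : ℕ) {n : ℕ} (κ : T → Fin n → ℕ) :
    MvPolynomial T ℂ →ₐ[ℂ] MvPolynomial (Fin n × ℕ) ℂ :=
  MvPolynomial.aeval fun x => MvPolynomial.monomial (diagExponent m (κ x)) 1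

theorem diagHom_prod {T : Type} (m : ℕ) {n : ℕ} (κ : T → Fin n → ℕ) (s : Multiset T) :
    diagHom m κ (s.map MvPolynomial.X).prod =
      MvPolynomial.monomial (s.map fun x => diagExponent m (κ x)).sum 1 := by
  induction s using Multiset.induction_on with
  | empty => simp
  | cons a s ih =>
    rw [Multiset.map_cons, Multiset.prod_cons, map_mul, ih, Multiset.map_cons, Multiset.sum_cons]
    simp [diagHom, MvPolynomial.monomial_mul]

theorem linearIndependent_chain_monomial {T : Type} {m n : ℕ} (hn : 0 < n)
    {κ : T → Fin n → ℕ} (hκ : Function.Injective κ) (h0 : ∀ x, κ x ⟨0, hn⟩ ≤ m)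
    (hle : ∀ x r, κ x r ≤ m + 1 + r) :
    LinearIndependent ℂ fun s : {s // IsChainMultiset κ s} =>
      MvPolynomial.monomial (s.1.map fun x => diagExponent m (κ x)).sum (1 : ℂ) := by
  have h1 : LinearIndependent ℂ fun e : Fin n × ℕ →₀ ℕ => MvPolynomial.monomial e (1 : ℂ) := by
    have := (MvPolynomial.basisMonomials (Fin n × ℕ) ℂ).linearIndependent
    rwa [MvPolynomial.coe_basisMonomials] at this
  exact h1.comp (fun s : {s // IsChainMultiset κ s} =>
    (s.1.map fun x => diagExponent m (κ x)).sum) fun s s' h =>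
      Subtype.ext (s.2.eq_of_sum_diagExponent_eq hn hκ h0 hle s'.2 h)

theorem ker_and_range_diagHom {T : Type} {m n : ℕ} (hn : 0 < n)
    {κ : T → Fin n → ℕ} (hκ : Function.Injective κ) (h0 : ∀ x, κ x ⟨0, hn⟩ ≤ m)
    (hle : ∀ x r, κ x r ≤ m + 1 + r) (Q : T → ℕ) (M : ℕ) (hM : ∀ x, Q x ≤ M)
    (I : Ideal (MvPolynomial T ℂ)) (hI : I ≤ RingHom.ker (diagHom m κ))
    (hstr : ∀ x y, ¬ κ x ≤ κ y → ¬ κ y ≤ κ x → ∃ u v, Q x + Q y < Q u + Q v ∧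
      (MvPolynomial.X x * MvPolynomial.X y - MvPolynomial.X u * MvPolynomial.X v :
        MvPolynomial T ℂ) ∈ I) :
    RingHom.ker (diagHom m κ) = I ∧ Subalgebra.toSubmodule (diagHom m κ).range =
      Submodule.span ℂ (Set.range fun s : {s // IsChainMultiset κ s} =>
        MvPolynomial.monomial (s.1.map fun x => diagExponent m (κ x)).sum (1 : ℂ)) := by
  let mkX : T → MvPolynomial T ℂ ⧸ I := fun x => Ideal.Quotient.mkₐ ℂ I (MvPolynomial.X x)
  have hmk : ∀ s : Multiset T, Ideal.Quotient.mkₐ ℂ I (s.map MvPolynomial.X).prod =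
      (s.map mkX).prod := fun s => by
    rw [map_multiset_prod, Multiset.map_map]; rfl
  have hspan : ∀ f : MvPolynomial T ℂ, ∃ c : {s // IsChainMultiset κ s} →₀ ℂ,
      f - c.sum (fun s a => a • (s.1.map MvPolynomial.X).prod) ∈ I := fun f => by
    have h1 : f ∈ Subalgebra.toSubmodule
        (Algebra.adjoin ℂ (Set.range (MvPolynomial.X : T → MvPolynomial T ℂ))) := by
      rw [MvPolynomial.adjoin_range_X]; trivial
    have h2 := Submodule.mem_map_of_mem (f := (Ideal.Quotient.mkₐ ℂ I).toLinearMap)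
      (adjoin_range_le_span_multiset_prod _ h1)
    rw [Submodule.map_span] at h2
    have h3 : Ideal.Quotient.mkₐ ℂ I f ∈ Submodule.span ℂ (Set.range fun s :
        {s // IsChainMultiset κ s} => (s.1.map mkX).prod) := by
      refine Submodule.span_le.2 ?_ h2
      rintro _ ⟨_, ⟨s, rfl⟩, rfl⟩
      change Ideal.Quotient.mkₐ ℂ I (s.map MvPolynomial.X).prod ∈ _
      rw [hmk]
      refine prod_mem_span_chain κ Q M hM mkX (fun x y hxy hyx => ?_) s
      obtain ⟨u, v, huv, hmem⟩ := hstr x y hxy hyx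
      refine Submodule.subset_span ⟨u, v, huv, ?_⟩
      have := (Ideal.Quotient.mk_eq_mk_iff_sub_mem _ _).2 hmem
      simpa [mkX] using this
    obtain ⟨c, hc⟩ := Finsupp.mem_span_range_iff_exists_finsupp.1 h3
    refine ⟨c, (Ideal.Quotient.mk_eq_mk_iff_sub_mem _ _).1 ?_⟩
    change Ideal.Quotient.mkₐ ℂ I f = Ideal.Quotient.mkₐ ℂ I _
    rw [← hc, Finsupp.sum, Finsupp.sum, map_sum]
    exact Finset.sum_congr rfl fun s _ => by rw [map_smul, hmk]
  have hval : ∀ (f : MvPolynomial T ℂ) (c : {s // IsChainMultiset κ s} →₀ ℂ),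
      f - c.sum (fun s a => a • (s.1.map MvPolynomial.X).prod) ∈ I →
      diagHom m κ f = c.sum fun s a =>
        a • MvPolynomial.monomial (s.1.map fun x => diagExponent m (κ x)).sum (1 : ℂ) :=
    fun f c hc => by
      have := hI hc
      rw [RingHom.mem_ker, map_sub, sub_eq_zero] at this
      rw [this, Finsupp.sum, Finsupp.sum, map_sum]
      exact Finset.sum_congr rfl fun s _ => by rw [map_smul, diagHom_prod]
  refine ⟨le_antisymm (fun f hf => ?_) hI, le_antisymm ?_ ?_⟩
  · obtain ⟨c, hc⟩ := hspan f
    have h1 := hval f c hc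
    rw [RingHom.mem_ker.1 hf] at h1
    have h2 : c = 0 := linearIndependent_iff.1
      (linearIndependent_chain_monomial hn hκ h0 hle) c h1.symm
    simpa [h2] using hc
  · rintro _ ⟨f, rfl⟩
    obtain ⟨c, hc⟩ := hspan f
    change diagHom m κ f ∈ _
    rw [hval f c hc]
    exact Submodule.sum_mem _ fun s _ => Submodule.smul_mem _ _ (Submodule.subset_span ⟨s, rfl⟩)
  · rw [Submodule.span_le]
    rintro _ ⟨s, rfl⟩
    exact ⟨_, diagHom_prod m κ s.1⟩

theorem of_dite_update {C : Type} {n : ℕ} {P : Fin n → Prop} [DecidablePred P]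
    [DecidableEq {r // P r}] (u : Fin n → Fin n → C) (v : {r // P r} → Fin n → C) (i : {r // P r})
    (z : Fin n → C) :
    (Matrix.of fun r => if h : P r then Function.update v i z ⟨r, h⟩ else u r) =
      Matrix.updateRow (Matrix.of fun r => if h : P r then v ⟨r, h⟩ else u r) i.1 z := by
  ext r j
  by_cases hr : r = i.1
  · subst hr
    simp [i.2]
  · rw [Matrix.updateRow_ne hr]
    by_cases h : P r
    · have : (⟨r, h⟩ : {r // P r}) ≠ i := fun e => hr (congrArg Subtype.val e)
      simp [h, this]
    · simp [h]

/-- The determinant as an alternating function of the rows satisfying `P`, the others being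
fixed to those of `u`. -/
def partialDet {C : Type} [CommRing C] {n : ℕ} (P : Fin n → Prop) [DecidablePred P]
    (u : Fin n → Fin n → C) : (Fin n → C) [⋀^{r // P r}]→ₗ[C] C where
  toFun v := Matrix.det (Matrix.of fun r => if h : P r then v ⟨r, h⟩ else u r)
  map_update_add' v i x y := by
    rw [of_dite_update, of_dite_update, of_dite_update, Matrix.det_updateRow_add]
  map_update_smul' v i c x := by
    rw [of_dite_update, of_dite_update, Matrix.det_updateRow_smul, smul_eq_mul]
  map_eq_zero_of_eq' v i j h hij := by
    refine Matrix.det_zero_of_row_eq (i := i.1) (j := j.1) (fun e => hij (Subtype.ext e)) ?_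
    ext c
    simp [i.2, j.2, h]

theorem partialDet_apply {C : Type} [CommRing C] {n : ℕ} (P : Fin n → Prop) [DecidablePred P]
    (u : Fin n → Fin n → C) (v : {r // P r} → Fin n → C) :
    partialDet P u v = Matrix.det (Matrix.of fun r => if h : P r then v ⟨r, h⟩ else u r) := rfl

/-- Antisymmetrizing a product of two alternating maps in too many vectors gives zero. -/
theorem sum_sign_smul_mul_eq_zero {C α β : Type} [CommRing C] [IsDomain C] {n : ℕ} [Fintype α]
    [Fintype β] [DecidableEq α] [DecidableEq β]
    (a : (Fin n → C) [⋀^α]→ₗ[C] C) (b : (Fin n → C) [⋀^β]→ₗ[C] C)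
    (hcard : n < Fintype.card α + Fintype.card β) (v : α ⊕ β → Fin n → C) :
    ∑ σ : Equiv.Perm (α ⊕ β), Equiv.Perm.sign σ •
      (a (fun i => v (σ (Sum.inl i))) * b (fun i => v (σ (Sum.inr i)))) = 0 := by
  let G := (LinearMap.mul' C C).compMultilinearMap
    (MultilinearMap.domCoprod a.toMultilinearMap b.toMultilinearMap)
  have h1 : MultilinearMap.alternatization G v = 0 := by
    refine AlternatingMap.map_linearDependent _ _ fun hli => ?_
    have := hli.fintype_card_le_finrank
    simp at this
    omega
  rw [MultilinearMap.alternatization_apply] at h1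
  rw [← h1]
  rfl

/-- The maximal minor formed by the vectors `cols (f r)`. -/
def maximalMinor {C : Type} [CommRing C] {n : ℕ} (cols : ℕ → Fin n → C) (f : Fin n → ℕ) : C :=
  Matrix.det (Matrix.of fun r => cols (f r))

/-- Columns of a maximal minor: strictly increasing with values in `{1, …, N}`. -/
def IsColumnSeq (n N : ℕ) (K : Fin n → ℕ) : Prop :=
  StrictMono K ∧ ∀ r, 1 ≤ K r ∧ K r ≤ N

theorem maximalMinor_eq_zero_or_sorted {C : Type} [CommRing C] {n N : ℕ} (cols : ℕ → Fin n → C)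
    (f : Fin n → ℕ) (hf : ∀ r, 1 ≤ f r ∧ f r ≤ N) :
    maximalMinor cols f = 0 ∨ ∃ K, IsColumnSeq n N K ∧ ∑ r, K r = ∑ r, f r ∧
      (maximalMinor cols f = maximalMinor cols K ∨
        maximalMinor cols f = -maximalMinor cols K) := by
  by_cases hinj : Function.Injective f
  · right
    refine ⟨f ∘ Tuple.sort f, ⟨(Tuple.monotone_sort f).strictMono_of_injective
      (hinj.comp (Tuple.sort f).injective), fun r => hf _⟩, Equiv.sum_comp (Tuple.sort f) f, ?_⟩
    have : maximalMinor cols (f ∘ Tuple.sort f) =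
        (Equiv.Perm.sign (Tuple.sort f) : ℤ) * maximalMinor cols f :=
      Matrix.det_permute (Tuple.sort f) (Matrix.of fun r => cols (f r))
    rcases Int.units_eq_one_or (Equiv.Perm.sign (Tuple.sort f)) with h | h <;>
      rw [this, h] <;> simp
  · left
    rw [Function.Injective] at hinj
    push Not at hinj
    obtain ⟨i, j, hij, hne⟩ := hinj
    exact Matrix.det_zero_of_row_eq hne (by ext; simp [hij])

theorem sum_comp_perm_lt {α β : Type} [Fintype α] [Fintype β] (w : α ⊕ β → ℕ) (c : ℕ)
    (hα : ∀ i, c ≤ w (Sum.inl i)) (hβ : ∀ j, w (Sum.inr j) < c) (σ : Equiv.Perm (α ⊕ β))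
    (hσ : ∃ i j, σ (Sum.inl i) = Sum.inr j) :
    ∑ i, w (σ (Sum.inl i)) < ∑ i, w (Sum.inl i) := by
  let w' : α ⊕ β → ℤ := Sum.elim (fun i => (w (Sum.inl i) : ℤ) - c) fun _ => 0
  have hle : ∀ x, (w x : ℤ) - c ≤ w' x := by
    rintro (i | j)
    · simp [w']
    · have := hβ j
      simp only [w', Sum.elim_inr]
      omega
  have hnn : ∀ x, 0 ≤ w' x := by
    rintro (i | j)
    · have := hα i
      simp only [w', Sum.elim_inl]
      omega
    · simp [w']
  have h1 : ∑ i, ((w (σ (Sum.inl i)) : ℤ) - c) < ∑ i, w' (σ (Sum.inl i)) := by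
    obtain ⟨i, j, hij⟩ := hσ
    refine Finset.sum_lt_sum (fun i _ => hle _) ⟨i, Finset.mem_univ _, ?_⟩
    have := hβ j
    rw [hij]
    simp only [w', Sum.elim_inr]
    omega
  have h2 : ∑ x, w' (σ x) = ∑ x, w' x := Equiv.sum_comp σ w'
  rw [Fintype.sum_sum_type, Fintype.sum_sum_type] at h2
  have h3 : 0 ≤ ∑ j, w' (σ (Sum.inr j)) := Finset.sum_nonneg fun j _ => hnn _
  have h4 : ∑ j : β, w' (Sum.inr j) = 0 := Finset.sum_eq_zero fun j _ => rfl
  have h5 : ∑ i : α, w' (Sum.inl i) = ∑ i : α, ((w (Sum.inl i) : ℤ) - c) := rfl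
  rw [Finset.sum_sub_distrib] at h1 h5
  zify
  linarith

theorem mem_of_sum_eq_zero {k C ι : Type} [CommRing k] [AddCommGroup C] [Module k C] [Algebra ℚ k]
    [Fintype ι] (W : Submodule k C) {t : ι → C} {z : C} (hsum : ∑ i, t i = 0)
    (ht : ∀ i, t i = z ∨ t i ∈ W) (i₀ : ι) (hi₀ : t i₀ = z) : z ∈ W := by
  classical
  rw [← Finset.sum_filter_add_sum_filter_not _ (fun i => t i = z),
    Finset.sum_congr rfl fun i hi => (Finset.mem_filter.1 hi).2, Finset.sum_const] at hsum
  set N := (Finset.univ.filter fun i => t i = z).card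
  have hN : (N : ℚ) ≠ 0 :=
    Nat.cast_ne_zero.2 (Finset.card_ne_zero_of_mem (Finset.mem_filter.2 ⟨Finset.mem_univ i₀, hi₀⟩))
  have h1 : N • z ∈ W := by
    rw [eq_neg_of_add_eq_zero_left hsum]
    exact W.neg_mem (W.sum_mem fun i hi => (ht i).resolve_left (Finset.mem_filter.1 hi).2)
  have h2 : algebraMap ℚ k (N : ℚ)⁻¹ • N • z = z := by
    rw [← Nat.cast_smul_eq_nsmul k, smul_smul, ← map_natCast (algebraMap ℚ k), ← map_mul,
      inv_mul_cancel₀ hN, map_one, one_smul]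
  exact h2 ▸ W.smul_mem _ h1

/-- Plücker straightening of a product of two maximal minors violating the column order. -/
theorem mul_maximalMinor_mem_span {k C : Type} [CommRing k] [CommRing C] [IsDomain C]
    [Algebra k C] [Algebra ℚ k] {n N : ℕ} (cols : ℕ → Fin n → C) {K L : Fin n → ℕ}
    (hK : IsColumnSeq n N K) (hL : IsColumnSeq n N L) (hKL : ¬ K ≤ L) :
    maximalMinor cols K * maximalMinor cols L ∈ Submodule.span k
      {z | ∃ U V, IsColumnSeq n N U ∧ IsColumnSeq n N V ∧ ∑ r, U r < ∑ r, K r ∧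
        ∑ r, U r + ∑ r, V r = ∑ r, K r + ∑ r, L r ∧
        z = maximalMinor cols U * maximalMinor cols V} := by
  set W := Submodule.span k
      {z | ∃ U V, IsColumnSeq n N U ∧ IsColumnSeq n N V ∧ ∑ r, U r < ∑ r, K r ∧
        ∑ r, U r + ∑ r, V r = ∑ r, K r + ∑ r, L r ∧
        z = maximalMinor cols U * maximalMinor cols V} with hW
  obtain ⟨r₀, hr₀⟩ := not_forall.1 hKL
  rw [not_le] at hr₀
  let α := {r : Fin n // r₀ ≤ r}
  let β := {r : Fin n // r ≤ r₀}
  let w : α ⊕ β → ℕ := Sum.elim (fun i => K i.1) fun j => L j.1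
  have hcard : n < Fintype.card α + Fintype.card β := by
    have h1 : Fintype.card α = n - r₀ := by
      simp [α, Fintype.card_subtype, Finset.filter_le_eq_Ici]
    have h2 : Fintype.card β = r₀ + 1 := by
      simp [β, Fintype.card_subtype, Finset.filter_ge_eq_Iic]
    have := r₀.2
    omega
  have hwα : ∀ i, K r₀ ≤ w (Sum.inl i) := fun i => hK.1.monotone i.2
  have hwβ : ∀ j, w (Sum.inr j) < K r₀ := fun j => (hL.1.monotone j.2).trans_lt hr₀
  have hwb : ∀ x, 1 ≤ w x ∧ w x ≤ N := by
    rintro (i | j)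
    · exact hK.2 _
    · exact hL.2 _
  let a := partialDet (C := C) (fun r => r₀ ≤ r) fun r => cols (K r)
  let b := partialDet (C := C) (fun r => r ≤ r₀) fun r => cols (L r)
  let f : Equiv.Perm (α ⊕ β) → Fin n → ℕ := fun σ r =>
    if h : r₀ ≤ r then w (σ (Sum.inl ⟨r, h⟩)) else K r
  let g : Equiv.Perm (α ⊕ β) → Fin n → ℕ := fun σ r =>
    if h : r ≤ r₀ then w (σ (Sum.inr ⟨r, h⟩)) else L r
  have ha : ∀ σ : Equiv.Perm (α ⊕ β),
      a (fun i => cols (w (σ (Sum.inl i)))) = maximalMinor cols (f σ) := fun σ => by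
    simp only [a, partialDet_apply, maximalMinor, f]
    congr 2
    ext r
    split_ifs <;> rfl
  have hb : ∀ σ : Equiv.Perm (α ⊕ β),
      b (fun i => cols (w (σ (Sum.inr i)))) = maximalMinor cols (g σ) := fun σ => by
    simp only [b, partialDet_apply, maximalMinor, g]
    congr 2
    ext r
    split_ifs <;> rfl
  have hf1 : f 1 = K := by ext r; simp [f, w]
  have hg1 : g 1 = L := by ext r; simp [g, w]
  have hsum := sum_sign_smul_mul_eq_zero a b hcard (fun x => cols (w x))
  simp only [ha, hb] at hsum
  have hfsum : ∀ σ, ∑ r, f σ r = ∑ i : α, w (σ (Sum.inl i)) + ∑ r : {r // ¬ r₀ ≤ r}, K r := by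
    intro σ
    rw [← Fintype.sum_subtype_add_sum_subtype (fun r => r₀ ≤ r) (f σ)]
    congr 1
    · exact Finset.sum_congr rfl fun i _ => by simp [f, i.2]
    · exact Finset.sum_congr rfl fun i _ => by simp only [f, i.2, dite_false]
  have hgsum : ∀ σ, ∑ r, g σ r = ∑ i : β, w (σ (Sum.inr i)) + ∑ r : {r // ¬ r ≤ r₀}, L r := by
    intro σ
    rw [← Fintype.sum_subtype_add_sum_subtype (fun r => r ≤ r₀) (g σ)]
    congr 1
    · exact Finset.sum_congr rfl fun i _ => by simp [g, i.2]
    · exact Finset.sum_congr rfl fun i _ => by simp only [g, i.2, dite_false]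
  have hfg : ∀ σ, ∑ r, f σ r + ∑ r, g σ r = ∑ r, K r + ∑ r, L r := by
    intro σ
    have h1 : ∑ x, w (σ x) = ∑ x, w x := Equiv.sum_comp σ w
    rw [Fintype.sum_sum_type, Fintype.sum_sum_type] at h1
    have h2 := hfsum 1
    have h3 := hgsum 1
    rw [hf1] at h2
    rw [hg1] at h3
    simp only [Equiv.Perm.one_apply] at h2 h3
    rw [hfsum, hgsum, h2, h3]
    omega
  have hterm : ∀ σ : Equiv.Perm (α ⊕ β),
      Equiv.Perm.sign σ • (maximalMinor cols (f σ) * maximalMinor cols (g σ)) =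
        maximalMinor cols K * maximalMinor cols L ∨
      Equiv.Perm.sign σ • (maximalMinor cols (f σ) * maximalMinor cols (g σ)) ∈ W := by
    intro σ
    by_cases hσ : ∃ i j, σ (Sum.inl i) = Sum.inr j
    · right
      suffices h : maximalMinor cols (f σ) * maximalMinor cols (g σ) ∈ W by
        rcases Int.units_eq_one_or (Equiv.Perm.sign σ) with hs | hs
        · simpa [hs] using h
        · simpa [hs, Units.smul_def] using h
      have hlt : ∑ r, f σ r < ∑ r, K r := by
        have h1 := sum_comp_perm_lt w (K r₀) hwα hwβ σ hσ
        have h2 := hfsum 1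
        rw [hf1] at h2
        simp only [Equiv.Perm.one_apply] at h2
        rw [hfsum, h2]
        omega
      rcases maximalMinor_eq_zero_or_sorted (N := N) cols (f σ) (fun r => by
        simp only [f]; split_ifs; exacts [hwb _, hK.2 r]) with h0 | ⟨U, hU, hUs, hUe⟩
      · simp [h0]
      rcases maximalMinor_eq_zero_or_sorted (N := N) cols (g σ) (fun r => by
        simp only [g]; split_ifs; exacts [hwb _, hL.2 r]) with h0 | ⟨V, hV, hVs, hVe⟩
      · simp [h0]
      have hmem : maximalMinor cols U * maximalMinor cols V ∈ W :=
        Submodule.subset_span ⟨U, V, hU, hV, hUs ▸ hlt, by rw [hUs, hVs, hfg], rfl⟩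
      rcases hUe with hUe | hUe <;> rcases hVe with hVe | hVe <;> rw [hUe, hVe] <;>
        simpa using hmem
    · left
      push Not at hσ
      obtain ⟨⟨σ₁, σ₂⟩, rfl⟩ := Equiv.Perm.mem_sumCongrHom_range_of_perm_mapsTo_inl (σ := σ) (by
        rintro _ ⟨i, rfl⟩
        rcases hx : σ (Sum.inl i) with j | j
        · exact ⟨j, rfl⟩
        · exact absurd hx (hσ i j))
      rw [← ha, ← hb]
      simp only [Equiv.Perm.sumCongrHom_apply, Equiv.sumCongr_apply, Sum.map_inl, Sum.map_inr]
      have h1 := a.map_perm (fun i => cols (w (Sum.inl i))) σ₁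
      have h2 := b.map_perm (fun i => cols (w (Sum.inr i))) σ₂
      have h3 := ha 1
      have h4 := hb 1
      rw [hf1] at h3
      rw [hg1] at h4
      simp only [Equiv.Perm.one_apply] at h3 h4
      rw [h3] at h1
      rw [h4] at h2
      simp only [Function.comp_def] at h1 h2
      rw [h1, h2, Equiv.Perm.sign_sumCongr]
      rcases Int.units_eq_one_or (Equiv.Perm.sign σ₁) with hs | hs <;>
      rcases Int.units_eq_one_or (Equiv.Perm.sign σ₂) with hs' | hs' <;>
        simp [hs, hs', Units.smul_def]
  refine mem_of_sum_eq_zero W hsum hterm 1 ?_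
  rw [hf1, hg1]
  simp

/-- The columns of the matrix `(z | 1)`, written as vectors; columns `1, …, m` are those of `z`,
columns `m + 1, …, m + n` the standard basis. -/
def augment {C : Type} [CommRing C] {n m : ℕ} (z : Fin n → Fin m → C) (c : ℕ) (i : Fin n) : C :=
  if h : 1 ≤ c ∧ c ≤ m then z i ⟨c - 1, by omega⟩ else if c = m + 1 + i then 1 else 0

theorem augment_succ {C : Type} [CommRing C] {n m : ℕ} (z : Fin n → Fin m → C) (j : Fin m)
    (i : Fin n) : augment z (j + 1) i = z i j := by
  have := j.2
  rw [augment, dif_pos ⟨by omega, by omega⟩]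
  rfl

theorem augment_add {C : Type} [CommRing C] {n m : ℕ} (z : Fin n → Fin m → C) (r : Fin n) :
    augment z (m + 1 + r) = Pi.single r 1 := by
  ext i
  rw [augment, dif_neg (by omega), Pi.single_apply]
  congr 1
  rw [Nat.add_left_cancel_iff, ← Fin.ext_iff]
  exact propext eq_comm

theorem maximalMinor_augment_top {C : Type} [CommRing C] {n m : ℕ} (z : Fin n → Fin m → C) :
    maximalMinor (augment z) (fun r => m + 1 + r) = 1 := by
  rw [maximalMinor, ← Matrix.det_one (n := Fin n)]
  congr 1
  ext r i
  rw [Matrix.of_apply, augment_add, Matrix.one_eq_pi_single]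

theorem maximalMinor_augment_update {C : Type} [CommRing C] {n m : ℕ} (z : Fin n → Fin m → C)
    (i : Fin n) (j : Fin m) :
    maximalMinor (augment z) (Function.update (fun r : Fin n => m + 1 + r) i (j + 1)) = z i j := by
  have h : (Matrix.of fun r =>
      augment z (Function.update (fun r : Fin n => m + 1 + (r : ℕ)) i (j + 1) r)) =
      Matrix.updateRow (1 : Matrix (Fin n) (Fin n) C) i (fun l => z l j) := by
    ext r l
    by_cases hr : r = i
    · subst hr
      simp [augment_succ]
    · rw [Matrix.updateRow_ne hr, Matrix.of_apply, Function.update_of_ne hr, augment_add,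
        Matrix.one_eq_pi_single]
  rw [maximalMinor, h, ← Matrix.cramer_transpose_apply, Matrix.transpose_one, Matrix.cramer_one]
  rfl

theorem IsColumnSeq.le {n m : ℕ} {K : Fin n → ℕ} (hK : IsColumnSeq n (n + m) K) (r : Fin n) :
    K r ≤ m + 1 + r := by
  have key : ∀ d : ℕ, ∀ r : Fin n, (r : ℕ) + d + 1 = n → K r ≤ m + 1 + r := fun d => by
    induction d with
    | zero =>
      intro r hr
      have := (hK.2 r).2
      omega
    | succ d ih =>
      intro r hr
      have h1 := ih ⟨r + 1, by omega⟩ (by simp only; omega)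
      have h2 := hK.1 (show r < ⟨r + 1, by omega⟩ from Fin.lt_def.2 (Nat.lt_succ_self _))
      simp only at h1
      omega
  exact key (n - 1 - r) r (by have := r.2; omega)

theorem IsColumnSeq.eq_top {n m : ℕ} (hn : 0 < n) {K : Fin n → ℕ} (hK : IsColumnSeq n (n + m) K)
    (h0 : m < K ⟨0, hn⟩) : K = fun r : Fin n => m + 1 + (r : ℕ) := by
  have key : ∀ (d : ℕ) (hd : d < n), m + 1 + d ≤ K ⟨d, hd⟩ := fun d => by
    induction d with
    | zero => exact fun _ => h0
    | succ d ih =>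
      intro hd
      have h1 := ih (by omega)
      have h2 := hK.1 (show (⟨d, by omega⟩ : Fin n) < ⟨d + 1, hd⟩ from
        Fin.lt_def.2 (Nat.lt_succ_self _))
      omega
  exact funext fun r => le_antisymm (hK.le r) (key r r.2)

theorem IsColumnSeq.sum_sq_le {n N : ℕ} {K : Fin n → ℕ} (hK : IsColumnSeq n N K) :
    (∑ r, K r) ^ 2 ≤ (n * N) ^ 2 := by
  refine Nat.pow_le_pow_left ?_ 2
  simpa using Finset.sum_le_card_nsmul Finset.univ K N fun r _ => (hK.2 r).2

theorem adjoin_maximalMinor_eq_top (k : Type) [CommRing k] (n m : ℕ) :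
    Algebra.adjoin k (Set.range fun K : {K // IsColumnSeq n (n + m) K} =>
      maximalMinor (augment fun i j => (MvPolynomial.X (i, j) :
        MvPolynomial (Fin n × Fin m) k)) K.1) = ⊤ := by
  rw [eq_top_iff, ← MvPolynomial.adjoin_range_X]
  refine Algebra.adjoin_le ?_
  rintro _ ⟨⟨i, j⟩, rfl⟩
  rw [SetLike.mem_coe, ← maximalMinor_augment_update (fun i j => (MvPolynomial.X (i, j) :
        MvPolynomial (Fin n × Fin m) k)) i j]
  rcases maximalMinor_eq_zero_or_sorted (N := n + m) (augment fun i j => (MvPolynomial.X (i, j) :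
        MvPolynomial (Fin n × Fin m) k)) (Function.update (fun r : Fin n => m + 1 + (r : ℕ)) i
          (j + 1)) (fun r => by
    by_cases hr : r = i
    · subst hr
      rw [Function.update_self]
      omega
    · rw [Function.update_of_ne hr]
      omega) with h | ⟨K, hK, -, h | h⟩ <;> rw [h]
  · exact Subalgebra.zero_mem _
  · exact Algebra.subset_adjoin ⟨⟨K, hK⟩, rfl⟩
  · exact Subalgebra.neg_mem _ (Algebra.subset_adjoin ⟨⟨K, hK⟩, rfl⟩)

theorem sq_add_sq_lt {a b u v : ℕ} (ha : u < a) (hb : u < b) (h : u + v = a + b) :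
    a ^ 2 + b ^ 2 < u ^ 2 + v ^ 2 := by
  obtain ⟨d, rfl⟩ := Nat.exists_eq_add_of_lt ha
  obtain rfl : v = b + d + 1 := by omega
  nlinarith

/-- The Plücker straightening law: products of minors along chains span. -/
theorem span_chain_maximalMinor_eq_top {k T : Type} [CommRing k] [IsDomain k] [Algebra ℚ k]
    {n m : ℕ} (hn : 0 < n) (κ : T → Fin n → ℕ)
    (hsurj : ∀ K, IsColumnSeq n (n + m) K → K ⟨0, hn⟩ ≤ m → ∃ x, κ x = K) :
    Submodule.span k (Set.range fun s : {s // IsChainMultiset κ s} =>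
      (s.1.map fun x => maximalMinor (augment fun i j => (MvPolynomial.X (i, j) :
        MvPolynomial (Fin n × Fin m) k)) (κ x)).prod) = ⊤ := by
  set cols := augment fun i j => (MvPolynomial.X (i, j) : MvPolynomial (Fin n × Fin m) k)
  let κ' : {K // IsColumnSeq n (n + m) K} → Fin n → ℕ := Subtype.val
  have hstrip : ∀ s : Multiset {K // IsColumnSeq n (n + m) K}, IsChainMultiset κ' s →
      ∃ s' : Multiset T, (∀ x ∈ s', ∃ y ∈ s, κ' y = κ x) ∧
        (s'.map fun x => maximalMinor cols (κ x)).prod =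
          (s.map fun x => maximalMinor cols (κ' x)).prod := by
    intro s hs
    induction s using Multiset.induction_on with
    | empty => exact ⟨0, by simp⟩
    | cons a s ih =>
      obtain ⟨s', hmem, hprod⟩ := ih fun x hx y hy =>
        hs x (Multiset.mem_cons_of_mem hx) y (Multiset.mem_cons_of_mem hy)
      by_cases ha : a.1 ⟨0, hn⟩ ≤ m
      · obtain ⟨x, hx⟩ := hsurj a.1 a.2 ha
        refine ⟨x ::ₘ s', fun y hy => ?_, ?_⟩
        · rcases Multiset.mem_cons.1 hy with rfl | hy
          · exact ⟨a, Multiset.mem_cons_self _ _, hx.symm⟩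
          · obtain ⟨z, hz, hzy⟩ := hmem y hy
            exact ⟨z, Multiset.mem_cons_of_mem hz, hzy⟩
        · simp [hprod, hx, κ']
      · refine ⟨s', fun y hy => ?_, ?_⟩
        · obtain ⟨z, hz, hzy⟩ := hmem y hy
          exact ⟨z, Multiset.mem_cons_of_mem hz, hzy⟩
        · have : maximalMinor cols (κ' a) = 1 := by
            rw [show κ' a = _ from a.2.eq_top hn (not_le.1 ha)]
            exact maximalMinor_augment_top _
          simp [hprod, this]
  rw [eq_top_iff, ← Algebra.top_toSubmodule, ← adjoin_maximalMinor_eq_top k n m]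
  refine (adjoin_range_le_span_multiset_prod _).trans (Submodule.span_le.2 ?_)
  rintro _ ⟨s, rfl⟩
  refine Submodule.span_le.2 ?_ (prod_mem_span_chain κ' (fun x => (∑ r, κ' x r) ^ 2)
    ((n * (n + m)) ^ 2) (fun x => x.2.sum_sq_le) (fun x => maximalMinor cols x.1)
    (fun x y hxy hyx => ?_) s)
  · rintro _ ⟨s, rfl⟩
    obtain ⟨s', hmem, hprod⟩ := hstrip s.1 s.2
    refine Submodule.subset_span ⟨⟨s', fun x hx y hy => ?_⟩, hprod⟩
    obtain ⟨x', hx', hxx⟩ := hmem x hx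
    obtain ⟨y', hy', hyy⟩ := hmem y hy
    rw [← hxx, ← hyy]
    exact s.2 x' hx' y' hy'
  · rcases le_total (∑ r, κ' x r) (∑ r, κ' y r) with hle | hle
    · refine Submodule.span_mono ?_ (mul_maximalMinor_mem_span cols x.2 y.2 hxy)
      rintro _ ⟨U, V, hU, hV, hlt, hsum, rfl⟩
      exact ⟨⟨U, hU⟩, ⟨V, hV⟩, sq_add_sq_lt hlt (hlt.trans_le hle) hsum, rfl⟩
    · rw [mul_comm]
      refine Submodule.span_mono ?_ (mul_maximalMinor_mem_span cols y.2 x.2 hyx)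
      rintro _ ⟨U, V, hU, hV, hlt, hsum, rfl⟩
      refine ⟨⟨U, hU⟩, ⟨V, hV⟩, ?_, rfl⟩
      rw [add_comm]
      exact sq_add_sq_lt hlt (hlt.trans_le hle) hsum

theorem sum_mul_perm_lt {n : ℕ} (m : ℕ) {K : Fin n → ℕ} (hK : StrictMono K)
    (σ : Equiv.Perm (Fin n)) (hσ : σ ≠ 1) :
    ∑ r : Fin n, (m + 1 + (r : ℤ)) * K (σ r) < ∑ r : Fin n, (m + 1 + (r : ℤ)) * K r := by
  have hmono : Monovary (fun r : Fin n => (m + 1 + (r : ℤ))) (fun r => (K r : ℤ)) := by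
    intro i j hij
    have := Fin.lt_def.1 (hK.lt_iff_lt.1 (Int.ofNat_lt.1 hij))
    simp only
    omega
  rw [hmono.sum_mul_comp_perm_lt_sum_mul_iff]
  intro hcon
  have hle : StrictMono ⇑σ⁻¹ := by
    refine Monotone.strictMono_of_injective (fun i j hij => ?_) (Equiv.injective _)
    rcases hij.eq_or_lt with rfl | hij
    · exact le_rfl
    have h1 : (K (σ (σ⁻¹ i)) : ℤ) < K (σ (σ⁻¹ j)) := by
      simpa using hK hij
    have h2 := hcon h1
    simp only at h2
    exact Fin.le_def.2 (by omega)
  have h3 : ⇑σ⁻¹ = id := (hle.range_inj strictMono_id).1 (by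
    rw [(Equiv.surjective _).range_eq, Set.range_id])
  refine hσ (inv_eq_one.1 (Equiv.ext fun r => ?_))
  rw [h3]
  rfl

/-- The exponent of `t` on the diagonal term of the minor with columns `K`. -/
def weight (m : ℕ) {n : ℕ} (K : Fin n → ℕ) : ℕ := ∑ r : Fin n, (m + 1 + r - K r) ^ 2

theorem weight_lt_weight_comp {m n : ℕ} {K : Fin n → ℕ} (hK : StrictMono K)
    (hle : ∀ r : Fin n, K r ≤ m + 1 + r) (σ : Equiv.Perm (Fin n)) (hσ : σ ≠ 1)
    (hσle : ∀ r : Fin n, K (σ r) ≤ m + 1 + r) : weight m K < weight m (K ∘ σ) := by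
  have hcast : ∀ L : Fin n → ℕ, (∀ r : Fin n, L r ≤ m + 1 + r) → (weight m L : ℤ) =
      ∑ r : Fin n, (m + 1 + (r : ℤ)) ^ 2 + ∑ r, (L r : ℤ) ^ 2 -
        2 * ∑ r : Fin n, (m + 1 + (r : ℤ)) * L r := fun L hL => by
    rw [weight, Nat.cast_sum, ← Finset.sum_add_distrib, Finset.mul_sum, ← Finset.sum_sub_distrib]
    refine Finset.sum_congr rfl fun r _ => ?_
    rw [Nat.cast_pow, Nat.cast_sub (hL r)]
    push_cast
    ring
  have h1 := hcast K hle
  have h2 := hcast (K ∘ σ) hσle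
  have h3 := sum_mul_perm_lt m hK σ hσ
  have h4 : ∑ r, ((K ∘ σ) r : ℤ) ^ 2 = ∑ r, (K r : ℤ) ^ 2 :=
    Equiv.sum_comp σ fun r => (K r : ℤ) ^ 2
  rw [h4] at h2
  simp only [Function.comp_apply] at h2
  zify
  linarith

/-- The columns of the deformed generic matrix: the entry of row `r` in column `c` is
`t ^ (m + 1 + r - c) ^ 2 * y r c` below the diagonal `c = m + 1 + r`, on which it is `1`. -/
def deformedCols (m n : ℕ) (c : ℕ) (r : Fin n) : MvPolynomial (Fin n × ℕ) (Polynomial ℂ) :=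
  if c < m + 1 + r then
    (Polynomial.X ^ (m + 1 + r - c) ^ 2 : Polynomial ℂ) • MvPolynomial.X (r, c)
  else if c = m + 1 + r then 1 else 0

theorem prod_deformedCols {m n : ℕ} {K : Fin n → ℕ} (hle : ∀ r : Fin n, K r ≤ m + 1 + r) :
    ∏ r, deformedCols m n (K r) r = (Polynomial.X ^ weight m K : Polynomial ℂ) •
      MvPolynomial.monomial (diagExponent m K) 1 := by
  rw [weight, diagExponent, ← Finset.prod_pow_eq_pow_sum, MvPolynomial.monomial_sum_one,
    ← Finset.prod_smul]
  refine Finset.prod_congr rfl fun r _ => ?_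
  rw [deformedCols]
  split_ifs with h1 h2
  · rfl
  · simp [h2]
  · exact absurd (hle r) (by omega)

theorem exists_maximalMinor_deformedCols {m n : ℕ} {K : Fin n → ℕ} (hK : StrictMono K)
    (hle : ∀ r : Fin n, K r ≤ m + 1 + r) :
    ∃ g, maximalMinor (deformedCols m n) K = (Polynomial.X ^ weight m K : Polynomial ℂ) • g ∧
      specialize _ 0 g = MvPolynomial.monomial (diagExponent m K) 1 := by
  have hterm : ∀ σ : Equiv.Perm (Fin n), σ ≠ 1 → ∃ h,
      Equiv.Perm.sign σ • ∏ r, deformedCols m n (K (σ r)) r =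
        (Polynomial.X ^ (weight m K + 1) : Polynomial ℂ) • h := fun σ hσ => by
    by_cases hσle : ∀ r : Fin n, K (σ r) ≤ m + 1 + r
    · obtain ⟨d, hd⟩ := Nat.exists_eq_add_of_le
        (Nat.succ_le_of_lt (weight_lt_weight_comp hK hle σ hσ hσle))
      refine ⟨Equiv.Perm.sign σ • (Polynomial.X ^ d : Polynomial ℂ) •
        MvPolynomial.monomial (diagExponent m (K ∘ σ)) 1, ?_⟩
      rw [smul_comm _ (Equiv.Perm.sign σ), smul_smul, ← pow_add, ← Nat.succ_eq_add_one, ← hd]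
      exact congrArg _ (prod_deformedCols hσle)
    · push Not at hσle
      obtain ⟨r, hr⟩ := hσle
      refine ⟨0, ?_⟩
      rw [Finset.prod_eq_zero (Finset.mem_univ r), smul_zero, smul_zero]
      rw [deformedCols, if_neg (by omega), if_neg (by omega)]
  choose! h hh using hterm
  refine ⟨MvPolynomial.monomial (diagExponent m K) 1 +
    (Polynomial.X : Polynomial ℂ) • ∑ σ ∈ Finset.univ.erase 1, h σ, ?_, ?_⟩
  · rw [maximalMinor, Matrix.det_apply, ← Finset.add_sum_erase _ _ (Finset.mem_univ 1), smul_add,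
      ← prod_deformedCols hle, smul_smul, ← pow_succ, Finset.smul_sum]
    congr 1
    · simp
    · exact Finset.sum_congr rfl fun σ hσ => hh σ (Finset.ne_of_mem_erase hσ)
  · rw [map_add, specialize_smul]
    simp [specialize]

/-- The parametrization of the generic matrix obtained from the deformed columns by normalizing
the last `n` of them to the identity matrix. -/
def deformation (m n : ℕ) : MvPolynomial (Fin n × Fin m) (Polynomial ℂ) →ₐ[Polynomial ℂ]
    MvPolynomial (Fin n × ℕ) (Polynomial ℂ) :=
  MvPolynomial.aeval fun p => Matrix.vecMul (deformedCols m n (p.2 + 1))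
    (Matrix.of fun r : Fin n => deformedCols m n (m + 1 + r)).adjugate p.1

theorem map_maximalMinor {C D : Type} [CommRing C] [CommRing D] (φ : C →+* D) {n : ℕ}
    (cols : ℕ → Fin n → C) (K : Fin n → ℕ) :
    φ (maximalMinor cols K) = maximalMinor (fun c i => φ (cols c i)) K := by
  rw [maximalMinor, RingHom.map_det]
  rfl

theorem det_deformedCols (m n : ℕ) :
    (Matrix.of fun r : Fin n => deformedCols m n (m + 1 + r)).det = 1 := by
  rw [Matrix.det_of_isUpperTriangular]
  · simp [deformedCols]
  · intro r i hri
    simp only [id] at hri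
    have := Fin.lt_def.1 hri
    rw [Matrix.of_apply, deformedCols, if_neg (by omega), if_neg (by omega)]

theorem deformation_maximalMinor {m n : ℕ} {K : Fin n → ℕ} (hK : IsColumnSeq n (n + m) K) :
    deformation m n (maximalMinor (augment fun i j => MvPolynomial.X (i, j)) K) =
      maximalMinor (deformedCols m n) K := by
  set U := Matrix.of fun r : Fin n => deformedCols m n (m + 1 + r) with hU
  have hcol : ∀ c, 1 ≤ c ∧ c ≤ n + m → Matrix.vecMul (fun i => deformation m n
      (augment (fun i j => MvPolynomial.X (i, j)) c i)) U = deformedCols m n c := by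
    intro c hc
    by_cases hcm : c ≤ m
    · obtain ⟨j, rfl⟩ : ∃ j : Fin m, c = j + 1 := ⟨⟨c - 1, by omega⟩, by simp only; omega⟩
      have : (fun i => deformation m n (augment (fun i j => MvPolynomial.X (i, j)) (j + 1) i)) =
          Matrix.vecMul (deformedCols m n (j + 1)) U.adjugate := by
        ext1 i
        rw [augment_succ, deformation, MvPolynomial.aeval_X]
      rw [this, Matrix.vecMul_vecMul, Matrix.adjugate_mul, det_deformedCols, one_smul,
        Matrix.vecMul_one]
    · obtain ⟨r, rfl⟩ : ∃ r : Fin n, c = m + 1 + r :=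
        ⟨⟨c - (m + 1), by omega⟩, by simp only; omega⟩
      have : (fun i => deformation m n (augment (fun i j => MvPolynomial.X (i, j)) (m + 1 + r) i)) =
          Pi.single r 1 := by
        ext1 i
        rw [augment_add, Pi.single_apply, Pi.single_apply, apply_ite (deformation m n), map_one,
          map_zero]
      rw [this, Matrix.single_one_vecMul]
      rfl
  have h1 := map_maximalMinor (deformation m n).toRingHom
    (augment fun i j => MvPolynomial.X (i, j)) K
  refine h1.trans ?_
  rw [maximalMinor, ← mul_one (Matrix.det _), ← det_deformedCols m n, ← hU, ← Matrix.det_mul,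
    maximalMinor]
  congr 1
  ext1 r
  exact fun i => congrFun (hcol (K r) (hK.2 r)) i

/-- Recovers the generic matrix from its deformation at `t = c ≠ 0`. -/
def deformationRetract (m n : ℕ) (c : ℂ) :
    MvPolynomial (Fin n × ℕ) ℂ →ₐ[ℂ] MvPolynomial (Fin n × Fin m) ℂ :=
  MvPolynomial.aeval fun p => if h : 1 ≤ p.2 ∧ p.2 ≤ m then
    (c ^ (m + 1 + p.1 - p.2) ^ 2)⁻¹ • MvPolynomial.X (p.1, ⟨p.2 - 1, by omega⟩) else 0

theorem deformationRetract_deformedCols {m n : ℕ} {c : ℂ} (hc : c ≠ 0) (k : ℕ) (hk : 1 ≤ k)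
    (r : Fin n) : deformationRetract m n c (specialize _ c (deformedCols m n k r)) =
      augment (fun i j => MvPolynomial.X (i, j)) k r := by
  rw [deformedCols, augment]
  by_cases hkm : k ≤ m
  · rw [dif_pos ⟨hk, hkm⟩, if_pos (by omega), specialize_smul, specialize_X, map_smul,
      deformationRetract, MvPolynomial.aeval_X, dif_pos ⟨hk, hkm⟩, smul_smul]
    simp [hc]
  · rw [dif_neg (by omega)]
    split_ifs with h1 h2 h2
    · omega
    · rw [specialize_smul, specialize_X, map_smul, deformationRetract, MvPolynomial.aeval_X,
        dif_neg (by omega), smul_zero]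
    · simp
    · simp

theorem deformationRetract_deformation {m n : ℕ} {c : ℂ} (hc : c ≠ 0)
    (a : MvPolynomial (Fin n × Fin m) (Polynomial ℂ)) :
    deformationRetract m n c (specialize _ c (deformation m n a)) = specialize _ c a := by
  let Θ : MvPolynomial (Fin n × ℕ) (Polynomial ℂ) →+* MvPolynomial (Fin n × Fin m) ℂ :=
    (deformationRetract m n c).toRingHom.comp (specialize _ c).toRingHom
  have hΘ : ∀ k, 1 ≤ k → ∀ r, Θ (deformedCols m n k r) =
      augment (fun i j => MvPolynomial.X (i, j)) k r :=
    fun k hk r => deformationRetract_deformedCols hc k hk r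
  suffices h : Θ.comp (deformation m n).toRingHom = (specialize _ c).toRingHom from
    DFunLike.congr_fun h a
  refine MvPolynomial.ringHom_ext (fun q => ?_) fun ⟨i, j⟩ => ?_
  · change deformationRetract m n c (specialize _ c (deformation m n (MvPolynomial.C q))) =
      specialize _ c (MvPolynomial.C q)
    rw [deformation, MvPolynomial.aeval_C, MvPolynomial.algebraMap_eq, specialize_C, specialize_C]
    simp
  · change Θ (deformation m n (MvPolynomial.X (i, j))) = specialize _ c (MvPolynomial.X (i, j))
    rw [specialize_X, deformation, MvPolynomial.aeval_X, RingHom.map_vecMul]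
    have h1 := Θ.map_adjugate (Matrix.of fun r : Fin n => deformedCols m n (m + 1 + r))
    have h2 : Θ.mapMatrix (Matrix.of fun r : Fin n => deformedCols m n (m + 1 + r)) = 1 := by
      ext1 r i
      rw [RingHom.mapMatrix_apply, Matrix.map_apply, Matrix.of_apply, hΘ _ (by omega),
        augment_add, Matrix.one_eq_pi_single]
    rw [h2, Matrix.adjugate_one, RingHom.mapMatrix_apply] at h1
    rw [h1, Matrix.vecMul_one]
    exact (hΘ _ (by omega) i).trans (augment_succ _ j i)

theorem exists_prod_deformation {T : Type} {m n : ℕ} {κ : T → Fin n → ℕ}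
    (hcol : ∀ x, IsColumnSeq n (n + m) (κ x)) (s : Multiset T) :
    ∃ g, deformation m n (s.map fun x =>
        maximalMinor (augment fun i j => MvPolynomial.X (i, j)) (κ x)).prod =
      (Polynomial.X ^ (s.map fun x => weight m (κ x)).sum : Polynomial ℂ) • g ∧
      specialize _ 0 g = MvPolynomial.monomial (s.map fun x => diagExponent m (κ x)).sum 1 := by
  induction s using Multiset.induction_on with
  | empty => exact ⟨1, by simp, by simp⟩
  | cons x s ih =>
    obtain ⟨g, hg, hg0⟩ := ih
    obtain ⟨f, hf, hf0⟩ := exists_maximalMinor_deformedCols (hcol x).1 (hcol x).le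
    refine ⟨f * g, ?_, ?_⟩
    · rw [Multiset.map_cons, Multiset.prod_cons, map_mul, hg, deformation_maximalMinor (hcol x), hf,
        Multiset.map_cons, Multiset.sum_cons, smul_mul_smul_comm, pow_add]
    · rw [map_mul, hf0, hg0, MvPolynomial.monomial_mul, one_mul, Multiset.map_cons,
        Multiset.sum_cons]

/-- The deformation statement for any lattice realized by column sequences. -/
theorem nonempty_flatDeform_of_columns {T : Type} {m n : ℕ} (hn : 0 < n) {κ : T → Fin n → ℕ}
    (hκ : Function.Injective κ) (hcol : ∀ x, IsColumnSeq n (n + m) (κ x))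
    (h0 : ∀ x, κ x ⟨0, hn⟩ ≤ m)
    (hsurj : ∀ K, IsColumnSeq n (n + m) K → K ⟨0, hn⟩ ≤ m → ∃ x, κ x = K)
    (Q : T → ℕ) (M : ℕ) (hM : ∀ x, Q x ≤ M)
    (I : Ideal (MvPolynomial T ℂ)) (hI : I ≤ RingHom.ker (diagHom m κ))
    (hstr : ∀ x y, ¬ κ x ≤ κ y → ¬ κ y ≤ κ x → ∃ u v, Q x + Q y < Q u + Q v ∧
      (MvPolynomial.X x * MvPolynomial.X y - MvPolynomial.X u * MvPolynomial.X v :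
        MvPolynomial T ℂ) ∈ I) :
    Nonempty (FlatDeform (MvPolynomial (Fin n × Fin m) ℂ) (MvPolynomial T ℂ ⧸ I)) := by
  have hle := fun x => (hcol x).le
  obtain ⟨hker, hrange⟩ := ker_and_range_diagHom hn hκ h0 hle Q M hM I hI hstr
  choose g hg hg0 using exists_prod_deformation hcol
  refine nonempty_flatDeform (deformation m n) (specialize _) (specialize _)
    specialize_eq_zero_iff specialize_eq_zero_iff (specialize_surjective _)
    (fun c hc a ha => ?_) (fun s : {s // IsChainMultiset κ s} => (s.1.map fun x =>
      maximalMinor (augment fun i j => MvPolynomial.X (i, j)) (κ x)).prod)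
    (span_chain_maximalMinor_eq_top hn κ hsurj) (fun s => (s.1.map fun x => weight m (κ x)).sum)
    (fun s => g s.1) (fun s => hg s.1) ?_ (diagHom m κ) I hker ?_
  · rw [← deformationRetract_deformation hc, ha, map_zero]
  · simp only [hg0]
    exact linearIndependent_chain_monomial hn hκ h0 hle
  · simp only [hg0]
    exact hrange

theorem pairwise_lt_eq_of_mem_iff {l l' : List ℕ} (hl : l.Pairwise (· < ·))
    (hl' : l'.Pairwise (· < ·)) (h : ∀ a, a ∈ l ↔ a ∈ l') : l = l' :=
  ((List.perm_ext_iff_of_nodup (hl.imp ne_of_lt) (hl'.imp ne_of_lt)).2 h).eq_of_pairwise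
    (fun _ _ _ _ h1 h2 => absurd h2 h1.asymm) hl hl'

theorem pairwise_range_succ (n : ℕ) : ((List.range n).map (· + 1)).Pairwise (· < ·) :=
  List.pairwise_map.2 (List.pairwise_lt_range.imp fun h => Nat.succ_lt_succ h)

theorem mem_range_succ {n a : ℕ} : a ∈ (List.range n).map (· + 1) ↔ 1 ≤ a ∧ a ≤ n := by
  simp only [List.mem_map, List.mem_range]
  exact ⟨by rintro ⟨b, hb, rfl⟩; omega, fun h => ⟨a - 1, by omega, by omega⟩⟩

theorem mem_xi {n m : ℕ} {I J : List ℕ} {c : ℕ} :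
    c ∈ xi n m I J ↔ c ∈ J ∨ ∃ i, (1 ≤ i ∧ i ≤ n) ∧ i ∉ I ∧ m + (n + 1 - i) = c := by
  simp only [xi, List.mem_append, List.mem_map, List.mem_reverse, List.mem_filter,
    decide_eq_true_eq, and_assoc]
  simp only [← List.mem_map, mem_range_succ, and_assoc]

theorem pairwise_xi {n m : ℕ} {I J : List ℕ} (hJ : J.Pairwise (· < ·)) (hJm : ∀ x ∈ J, x ≤ m) :
    (xi n m I J).Pairwise (· < ·) := by
  rw [xi, List.pairwise_append]
  refine ⟨hJ, ?_, fun a ha b hb => ?_⟩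
  · rw [List.pairwise_map, List.pairwise_reverse]
    refine List.Pairwise.imp_of_mem (fun {a b} _ hb hab => ?_)
      ((pairwise_range_succ n).filter _)
    have := mem_range_succ.1 (List.mem_of_mem_filter hb)
    omega
  · obtain ⟨i, hi, rfl⟩ := List.mem_map.1 hb
    have h1 := mem_range_succ.1 (List.mem_of_mem_filter (List.mem_reverse.1 hi))
    have h2 := hJm a ha
    omega

theorem length_xi {n m : ℕ} {I J : List ℕ} (hI : I.Pairwise (· < ·))
    (hIn : ∀ x ∈ I, 1 ≤ x ∧ x ≤ n) : (xi n m I J).length + I.length = J.length + n := by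
  have h1 : ((List.range n).map (· + 1)).filter (fun c => !decide (c ∉ I)) = I := by
    refine pairwise_lt_eq_of_mem_iff ((pairwise_range_succ n).filter _) hI fun a => ?_
    rw [List.mem_filter, mem_range_succ]
    simpa using hIn a
  have h2 := List.length_eq_length_filter_add (l := (List.range n).map (· + 1))
    (fun c => decide (c ∉ I))
  rw [h1, List.length_map, List.length_range] at h2
  rw [xi, List.length_append, List.length_map, List.length_reverse]
  omega

theorem mem_xiInvI {n m : ℕ} {K : List ℕ} {i : ℕ} :
    i ∈ xiInvI n m K ↔ (1 ≤ i ∧ i ≤ n) ∧ m + (n + 1 - i) ∉ K := by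
  rw [xiInvI, List.mem_filter, mem_range_succ, decide_eq_true_eq]

theorem mem_xiInvJ {m : ℕ} {K : List ℕ} {j : ℕ} : j ∈ xiInvJ m K ↔ j ∈ K ∧ j ≤ m := by
  rw [xiInvJ, List.mem_filter, decide_eq_true_eq]

theorem pairwise_xiInvI (n m : ℕ) (K : List ℕ) : (xiInvI n m K).Pairwise (· < ·) :=
  (pairwise_range_succ n).filter _

theorem pairwise_xiInvJ {m : ℕ} {K : List ℕ} (hK : K.Pairwise (· < ·)) :
    (xiInvJ m K).Pairwise (· < ·) :=
  hK.filter _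

theorem isTab.pairwise {n m : ℕ} {I J : List ℕ} (h : isTab n m I J) :
    I.Pairwise (· < ·) ∧ J.Pairwise (· < ·) :=
  ⟨List.isChain_iff_pairwise.1 h.2.2.1, List.isChain_iff_pairwise.1 h.2.2.2.1⟩

theorem isTab.xiInvI_xi {n m : ℕ} {I J : List ℕ} (h : isTab n m I J) :
    xiInvI n m (xi n m I J) = I := by
  refine pairwise_lt_eq_of_mem_iff (pairwise_xiInvI _ _ _) h.pairwise.1 fun i => ?_
  rw [mem_xiInvI, mem_xi]
  constructor
  · rintro ⟨hi, hni⟩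
    by_contra hcon
    exact hni (Or.inr ⟨i, hi, hcon, rfl⟩)
  · refine fun hi => ⟨h.2.2.2.2.1 i hi, ?_⟩
    have hin := h.2.2.2.2.1 i hi
    rintro (hJ | ⟨i', hi', hni, he⟩)
    · have := (h.2.2.2.2.2 _ hJ).2
      omega
    · obtain rfl : i' = i := by omega
      exact hni hi

theorem isTab.xiInvJ_xi {n m : ℕ} {I J : List ℕ} (h : isTab n m I J) :
    xiInvJ m (xi n m I J) = J := by
  have hJ := h.2.2.2.2.2
  refine pairwise_lt_eq_of_mem_iff (pairwise_xiInvJ (pairwise_xi h.pairwise.2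
    fun x hx => (hJ x hx).2)) h.pairwise.2 fun j => ?_
  rw [mem_xiInvJ, mem_xi]
  constructor
  · rintro ⟨hj | ⟨i, hi, -, rfl⟩, hjm⟩
    · exact hj
    · omega
  · exact fun hj => ⟨Or.inl hj, (hJ j hj).2⟩

theorem xi_xiInv {n m : ℕ} {K : List ℕ} (hK : K.Pairwise (· < ·))
    (hKb : ∀ c ∈ K, 1 ≤ c ∧ c ≤ n + m) : xi n m (xiInvI n m K) (xiInvJ m K) = K := by
  refine pairwise_lt_eq_of_mem_iff (pairwise_xi (pairwise_xiInvJ hK)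
    fun x hx => (mem_xiInvJ.1 hx).2) hK fun c => ?_
  rw [mem_xi, mem_xiInvJ]
  constructor
  · rintro (h | ⟨i, hi, hni, rfl⟩)
    · exact h.1
    · rw [mem_xiInvI] at hni
      by_contra hcon
      exact hni ⟨hi, hcon⟩
  · intro hc
    have hb := hKb c hc
    by_cases hcm : c ≤ m
    · exact Or.inl ⟨hc, hcm⟩
    · have he : m + (n + 1 - (n + 1 - (c - m))) = c := by omega
      refine Or.inr ⟨n + 1 - (c - m), by omega, fun hmem => ?_, he⟩
      have := (mem_xiInvI.1 hmem).2
      rw [he] at this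
      exact this hc

theorem isTab_xiInv {n m : ℕ} {K : List ℕ} (hK : K.Pairwise (· < ·)) (hlen : K.length = n)
    (hKb : ∀ c ∈ K, 1 ≤ c ∧ c ≤ n + m) (hex : ∃ c ∈ K, c ≤ m) :
    isTab n m (xiInvI n m K) (xiInvJ m K) := by
  have hI : ∀ x ∈ xiInvI n m K, 1 ≤ x ∧ x ≤ n := fun x hx => (mem_xiInvI.1 hx).1
  have h1 := length_xi (m := m) (J := xiInvJ m K) (pairwise_xiInvI n m K) hI
  rw [xi_xiInv hK hKb] at h1
  have h2 : (xiInvI n m K).length = (xiInvJ m K).length := by omega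
  obtain ⟨c, hc, hcm⟩ := hex
  have h3 := List.length_pos_of_mem (mem_xiInvJ.2 ⟨hc, hcm⟩)
  exact ⟨h2, List.ne_nil_of_length_pos (h2 ▸ h3), (pairwise_xiInvI n m K).isChain,
    (pairwise_xiInvJ hK).isChain, hI, fun x hx =>
      ⟨(hKb x (mem_xiInvJ.1 hx).1).1, (mem_xiInvJ.1 hx).2⟩⟩

/-- The column sequence of a one-line tableau. -/
def tabColumns {n m : ℕ} (x : {s : List ℕ × List ℕ // isTab n m s.1 s.2}) (r : Fin n) : ℕ :=
  (xi n m x.1.1 x.1.2).getD r 0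

theorem ofFn_tabColumns {n m : ℕ} (x : {s : List ℕ × List ℕ // isTab n m s.1 s.2}) :
    List.ofFn (tabColumns x) = xi n m x.1.1 x.1.2 := by
  have hlen : (xi n m x.1.1 x.1.2).length = n := by
    have h1 := length_xi (m := m) (J := x.1.2) x.2.pairwise.1 x.2.2.2.2.2.1
    have h2 := x.2.1
    omega
  refine List.ext_getElem (by simp [hlen]) fun i h1 h2 => ?_
  simp [tabColumns, h2]

theorem isColumnSeq_iff_ofFn {n N : ℕ} {K : Fin n → ℕ} : IsColumnSeq n N K ↔
    (List.ofFn K).Pairwise (· < ·) ∧ ∀ c ∈ List.ofFn K, 1 ≤ c ∧ c ≤ N := by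
  rw [IsColumnSeq, List.pairwise_ofFn, List.forall_mem_ofFn_iff]
  rfl

theorem isColumnSeq_tabColumns {n m : ℕ} (x : {s : List ℕ × List ℕ // isTab n m s.1 s.2}) :
    IsColumnSeq n (n + m) (tabColumns x) := by
  have hJ := x.2.2.2.2.2.2
  rw [isColumnSeq_iff_ofFn, ofFn_tabColumns]
  refine ⟨pairwise_xi x.2.pairwise.2 fun a ha => (hJ a ha).2, fun c hc => ?_⟩
  rcases mem_xi.1 hc with h | ⟨i, hi, -, rfl⟩
  · have := hJ c h
    omega
  · omega

theorem tabColumns_zero_le {n m : ℕ} (hn : 0 < n)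
    (x : {s : List ℕ × List ℕ // isTab n m s.1 s.2}) : tabColumns x ⟨0, hn⟩ ≤ m := by
  have h1 : 0 < x.1.2.length := x.2.1 ▸ List.length_pos_iff.2 x.2.2.1
  have h2 : tabColumns x ⟨0, hn⟩ = x.1.2[0] := by
    rw [tabColumns, xi, List.getD_append _ _ _ _ h1, List.getD_eq_getElem _ _ h1]
  rw [h2]
  exact (x.2.2.2.2.2.2 _ (List.getElem_mem h1)).2

theorem tabColumns_injective (n m : ℕ) : Function.Injective
    (tabColumns : {s : List ℕ × List ℕ // isTab n m s.1 s.2} → Fin n → ℕ) := by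
  intro x y h
  have h1 := congrArg List.ofFn h
  rw [ofFn_tabColumns, ofFn_tabColumns] at h1
  refine Subtype.ext (Prod.ext ?_ ?_)
  · rw [← x.2.xiInvI_xi, h1, y.2.xiInvI_xi]
  · rw [← x.2.xiInvJ_xi, h1, y.2.xiInvJ_xi]

theorem isTab_xiInv_ofFn {n m : ℕ} (hn : 0 < n) {K : Fin n → ℕ} (hK : IsColumnSeq n (n + m) K)
    (h0 : K ⟨0, hn⟩ ≤ m) : isTab n m (xiInvI n m (List.ofFn K)) (xiInvJ m (List.ofFn K)) :=
  isTab_xiInv (isColumnSeq_iff_ofFn.1 hK).1 List.length_ofFn (isColumnSeq_iff_ofFn.1 hK).2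
    ⟨_, List.mem_ofFn.2 ⟨⟨0, hn⟩, rfl⟩, h0⟩

theorem tabColumns_xiInv {n m : ℕ} {K : Fin n → ℕ} (hK : IsColumnSeq n (n + m) K)
    (h : isTab n m (xiInvI n m (List.ofFn K)) (xiInvJ m (List.ofFn K))) :
    tabColumns ⟨(xiInvI n m (List.ofFn K), xiInvJ m (List.ofFn K)), h⟩ = K := by
  apply List.ofFn_injective
  rw [ofFn_tabColumns]
  exact xi_xiInv (isColumnSeq_iff_ofFn.1 hK).1 (isColumnSeq_iff_ofFn.1 hK).2

theorem zipWith_ofFn {n : ℕ} (f : ℕ → ℕ → ℕ) (K L : Fin n → ℕ) :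
    List.zipWith f (List.ofFn K) (List.ofFn L) = List.ofFn fun r => f (K r) (L r) :=
  List.ext_getElem (by simp) fun i h1 h2 => by simp

theorem exists_tabMeet {n m : ℕ} (hn : 0 < n) (x y : {s : List ℕ × List ℕ // isTab n m s.1 s.2}) :
    ∃ u : {s : List ℕ × List ℕ // isTab n m s.1 s.2}, u.1 = tabMeet n m x.1 y.1 ∧
      ∀ r, tabColumns u r = min (tabColumns x r) (tabColumns y r) := by
  have hx := isColumnSeq_tabColumns x
  have hy := isColumnSeq_tabColumns y
  have hK : IsColumnSeq n (n + m) fun r => min (tabColumns x r) (tabColumns y r) :=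
    ⟨fun r s h => min_lt_min (hx.1 h) (hy.1 h), fun r =>
      ⟨le_min (hx.2 r).1 (hy.2 r).1, (min_le_left _ _).trans (hx.2 r).2⟩⟩
  have h := isTab_xiInv_ofFn hn hK ((min_le_left _ _).trans (tabColumns_zero_le hn x))
  refine ⟨⟨_, h⟩, ?_, congrFun (tabColumns_xiInv hK h)⟩
  rw [tabMeet, ← ofFn_tabColumns, ← ofFn_tabColumns, zipWith_ofFn]

theorem exists_tabJoin {n m : ℕ} (hn : 0 < n) (x y : {s : List ℕ × List ℕ // isTab n m s.1 s.2}) :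
    ∃ v : {s : List ℕ × List ℕ // isTab n m s.1 s.2}, v.1 = tabJoin n m x.1 y.1 ∧
      ∀ r, tabColumns v r = max (tabColumns x r) (tabColumns y r) := by
  have hx := isColumnSeq_tabColumns x
  have hy := isColumnSeq_tabColumns y
  have hK : IsColumnSeq n (n + m) fun r => max (tabColumns x r) (tabColumns y r) :=
    ⟨fun r s h => max_lt_max (hx.1 h) (hy.1 h), fun r =>
      ⟨(hx.2 r).1.trans (le_max_left _ _), max_le (hx.2 r).2 (hy.2 r).2⟩⟩
  have h := isTab_xiInv_ofFn hn hK (max_le (tabColumns_zero_le hn x) (tabColumns_zero_le hn y))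
  refine ⟨⟨_, h⟩, ?_, congrFun (tabColumns_xiInv hK h)⟩
  rw [tabJoin, ← ofFn_tabColumns, ← ofFn_tabColumns, zipWith_ofFn]

theorem hVar_val {P : List ℕ × List ℕ → Prop} (u : {s // P s}) : hVar P u.1 = MvPolynomial.X u :=
  dif_pos u.2

theorem diagExponent_add_of_min_max {m n : ℕ} {K L U V : Fin n → ℕ}
    (hU : ∀ r, U r = min (K r) (L r)) (hV : ∀ r, V r = max (K r) (L r)) :
    diagExponent m K + diagExponent m L = diagExponent m U + diagExponent m V := by
  ext ⟨r, c⟩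
  simp only [Finsupp.add_apply, diagExponent_apply, hU, hV]
  rcases le_total (K r) (L r) with h | h
  · rw [min_eq_left h, max_eq_right h]
  · rw [min_eq_right h, max_eq_left h, add_comm]

theorem sum_min_lt {n : ℕ} {K L : Fin n → ℕ} (h : ¬ K ≤ L) :
    ∑ r, min (K r) (L r) < ∑ r, K r := by
  obtain ⟨r, hr⟩ := not_forall.1 h
  exact Finset.sum_lt_sum (fun i _ => min_le_left _ _)
    ⟨r, Finset.mem_univ r, min_lt_iff.2 (Or.inr (not_le.1 hr))⟩

/-- `ℂ[M_{n,m}]` is a flat deformation of the Hibi algebra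
`H_{D(n,m)}` : there is a flat `ℂ[t]`-algebra whose fiber at every `t = c ≠ 0` is
`ℂ[M_{n,m}]` and whose fiber at `t = 0` is `H_{D(n,m)}`. -/
theorem CMnm_flat_deformation_of_Hibi (n m : ℕ) (hn : 0 < n) (hm : 0 < m) :
    Nonempty (FlatDeform (MvPolynomial (Fin n × Fin m) ℂ)
      (MvPolynomial {s : List ℕ × List ℕ // isTab n m s.1 s.2} ℂ ⧸
        hibiIdeal (fun s => isTab n m s.1 s.2) (tabMeet n m) (tabJoin n m))) := by
  refine nonempty_flatDeform_of_columns hn (tabColumns_injective n m) isColumnSeq_tabColumns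
    (tabColumns_zero_le hn)
    (fun K hK h0 => ⟨_, tabColumns_xiInv hK (isTab_xiInv_ofFn hn hK h0)⟩)
    (fun x => (∑ r, tabColumns x r) ^ 2) ((n * (n + m)) ^ 2)
    (fun x => (isColumnSeq_tabColumns x).sum_sq_le) _ (Ideal.span_le.2 ?_) fun x y hxy hyx => ?_
  · rintro _ ⟨x, y, rfl⟩
    obtain ⟨u, hu, hmin⟩ := exists_tabMeet hn x y
    obtain ⟨v, hv, hmax⟩ := exists_tabJoin hn x y
    rw [← hu, ← hv, hVar_val u, hVar_val v, SetLike.mem_coe, RingHom.mem_ker]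
    simp only [map_sub, map_mul, diagHom, MvPolynomial.aeval_X, MvPolynomial.monomial_mul]
    rw [diagExponent_add_of_min_max hmin hmax, sub_self]
  · obtain ⟨u, hu, hmin⟩ := exists_tabMeet hn x y
    obtain ⟨v, hv, hmax⟩ := exists_tabJoin hn x y
    refine ⟨u, v, sq_add_sq_lt ?_ ?_ ?_, Ideal.subset_span ⟨x, y, ?_⟩⟩
    · simpa only [hmin] using sum_min_lt hxy
    · simpa only [hmin, min_comm] using sum_min_lt hyx
    · simp only [hmin, hmax, ← Finset.sum_add_distrib, min_add_max]
    · rw [← hu, ← hv, hVar_val u, hVar_val v]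

end
end

section
/- The set Θ = {Σ_d c_d δ_{[I:J_d]} : Σ_d c_d J_d an ω-sum of Sp_{2n}, I a strictly increasing sequence in {1,…,k} of the common length of the J_d} generates the ideal I of ℂ[M_{k,2n}] generated by the basic symplectic invariants {r_{ij} : 1 ≤ i < j ≤ k}. -/
noncomputable section

/-- `dmin n m I J` is the minor δ_{[I:J]} ∈ ℂ[M_{n,m}] : the determinant of the submatrix of
the generic n×m matrix of variables with rows `I` and columns `J` (1-based indices). -/
def dmin (n m : ℕ) (I J : List ℕ) : MvPolynomial (Fin n × Fin m) ℂ :=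
  Matrix.det (Matrix.of fun a b : Fin I.length =>
    if h : I.getD a 0 - 1 < n ∧ J.getD b 0 - 1 < m then
      MvPolynomial.X (⟨I.getD a 0 - 1, h.1⟩, ⟨J.getD b 0 - 1, h.2⟩)
    else 0)

/-- The basic symplectic invariant `r_{ij} = ∑_u (x_{i,2u−1}x_{j,2u} − x_{j,2u−1}x_{i,2u})`
(with 0-based variable indices). -/
def rbase (k n : ℕ) (i j : Fin k) : MvPolynomial (Fin k × Fin (2 * n)) ℂ :=
  ∑ u : Fin n,
    (MvPolynomial.X (i, ⟨2 * u.1, by have := u.isLt; omega⟩) *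
        MvPolynomial.X (j, ⟨2 * u.1 + 1, by have := u.isLt; omega⟩) -
      MvPolynomial.X (j, ⟨2 * u.1, by have := u.isLt; omega⟩) *
        MvPolynomial.X (i, ⟨2 * u.1 + 1, by have := u.isLt; omega⟩))

/-- The ideal `I` of the nullcone, generated by the basic symplectic invariants. -/
def sympIdeal (k n : ℕ) : Ideal (MvPolynomial (Fin k × Fin (2 * n)) ℂ) :=
  Ideal.span {f | ∃ i j : Fin k, i < j ∧ f = rbase k n i j}

/-- The elementary wedge `e_J = e_{j₁} ∧ ⋯ ∧ e_{j_p}` (1-based entries). -/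
def eW (n : ℕ) (J : List ℕ) : ExteriorAlgebra ℂ (Fin (2 * n) → ℂ) :=
  (J.map fun j =>
    if h : j - 1 < 2 * n then
      ExteriorAlgebra.ι ℂ (Pi.single (⟨j - 1, h⟩ : Fin (2 * n)) 1)
    else 0).prod

/-- `ω = ∑_u e_{2u−1} ∧ e_{2u} ∈ Λ²ℂ^{2n}`. -/
def omegaW (n : ℕ) : ExteriorAlgebra ℂ (Fin (2 * n) → ℂ) :=
  ∑ u : Fin n,
    ExteriorAlgebra.ι ℂ (Pi.single (⟨2 * u.1, by have := u.isLt; omega⟩ : Fin (2 * n)) 1) *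
      ExteriorAlgebra.ι ℂ (Pi.single (⟨2 * u.1 + 1, by have := u.isLt; omega⟩ : Fin (2 * n)) 1)

/-- `Λ^p ℂ^{2n}` as a submodule of the exterior algebra. -/
def wedgePow (n p : ℕ) : Submodule ℂ (ExteriorAlgebra ℂ (Fin (2 * n) → ℂ)) :=
  (LinearMap.range (ExteriorAlgebra.ι ℂ :
      (Fin (2 * n) → ℂ) →ₗ[ℂ] ExteriorAlgebra ℂ (Fin (2 * n) → ℂ))) ^ p

/-- `isOmegaSum n p S c` : `∑_{J ∈ S} c J • e_J` is an ω-sum of `Sp_{2n}`, all `J ∈ S` being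
strictly increasing sequences in `{1,…,2n}` of common length `p ≥ 2`. -/
def isOmegaSum (n p : ℕ) (S : Finset (List ℕ)) (c : List ℕ → ℂ) : Prop :=
  2 ≤ p ∧ (∀ J ∈ S, J.Chain' (· < ·) ∧ (∀ x ∈ J, 1 ≤ x ∧ x ≤ 2 * n) ∧ J.length = p) ∧
    ∃ x ∈ wedgePow n (p - 2), (∑ J ∈ S, c J • eW n J) = omegaW n * x

/-- A 2-tensor `∑ u, v u ∧ w u` vanishes as soon as its coefficient matrix is symmetric. -/
theorem sum_ι_mul_ι_eq_zero {A ι κ : Type*} [CommRing A] [Algebra ℂ A] [Fintype ι]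
    [Fintype κ] [DecidableEq κ] (v w : ι → κ → A)
    (h : ∀ a b, ∑ u, v u a * w u b = ∑ u, v u b * w u a) :
    ∑ u, ExteriorAlgebra.ι A (v u) * ExteriorAlgebra.ι A (w u) = 0 := by
  set ε : κ → ExteriorAlgebra A (κ → A) := fun a => ExteriorAlgebra.ι A (Pi.single a 1)
  have expand (x : κ → A) : ExteriorAlgebra.ι A x = ∑ a, x a • ε a := by
    conv_lhs => rw [pi_eq_sum_univ' x]
    simp only [map_sum, map_smul, ε]
  have key : ∑ u, ExteriorAlgebra.ι A (v u) * ExteriorAlgebra.ι A (w u) =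
      ∑ a, ∑ b, (∑ u, v u a * w u b) • (ε a * ε b) := by
    simp only [expand, Finset.sum_mul_sum, smul_mul_smul_comm, Finset.sum_smul]
    rw [Finset.sum_comm]
    exact Finset.sum_congr rfl fun a _ => Finset.sum_comm
  have anti (a b : κ) : ε a * ε b = -(ε b * ε a) :=
    eq_neg_of_add_eq_zero_left (ExteriorAlgebra.ι_add_mul_swap _ _)
  rw [key]
  have : IsAddTorsionFree (ExteriorAlgebra A (κ → A)) := .of_isTorsionFree ℂ _
  refine self_eq_neg.mp ?_
  refine Finset.sum_comm.trans ?_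
  rw [← Finset.sum_neg_distrib]
  refine Finset.sum_congr rfl fun a _ => ?_
  rw [← Finset.sum_neg_distrib]
  refine Finset.sum_congr rfl fun b _ => ?_
  rw [h b a, anti b a, smul_neg]

/-- The algebra map `Λ(ℂ^m) → Λ_A(A^p)` which sends each `e_j` to the `j`-th column `x j`. -/
def columnMap {A : Type*} [CommRing A] [Algebra ℂ A] {m p : ℕ} (x : Fin m → Fin p → A) :
    ExteriorAlgebra ℂ (Fin m → ℂ) →ₐ[ℂ] ExteriorAlgebra A (Fin p → A) :=
  ExteriorAlgebra.lift ℂ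
    ⟨(ExteriorAlgebra.ι A).restrictScalars ℂ ∘ₗ Fintype.linearCombination ℂ x,
      fun v => by
        rw [LinearMap.comp_apply, LinearMap.restrictScalars_apply, ExteriorAlgebra.ι_sq_zero]⟩

theorem columnMap_ι_single {A : Type*} [CommRing A] [Algebra ℂ A] {m p : ℕ}
    (x : Fin m → Fin p → A) (j : Fin m) :
    columnMap x (ExteriorAlgebra.ι ℂ (Pi.single j 1)) = ExteriorAlgebra.ι A (x j) := by
  rw [columnMap, ExteriorAlgebra.lift_ι_apply]
  simp [Fintype.linearCombination_apply_single]

/-- The top-degree coefficient `Λ(A^p) → A`, given on `Λ^p` by the determinant. -/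
def detCoeff (A : Type*) [CommRing A] (p : ℕ) : ExteriorAlgebra A (Fin p → A) →ₗ[A] A :=
  ExteriorAlgebra.liftAlternating
    (Pi.single p Matrix.detRowAlternating : ∀ i, (Fin p → A) [⋀^Fin i]→ₗ[A] A)

theorem detCoeff_ιMulti {A : Type*} [CommRing A] {p : ℕ} (v : Fin p → Fin p → A) :
    detCoeff A p (ExteriorAlgebra.ιMulti A p v) = Matrix.det (Matrix.of v) := by
  rw [detCoeff, ExteriorAlgebra.liftAlternating_apply_ιMulti, Pi.single_eq_same]
  rfl

theorem rbase_mem_sympIdeal (k n : ℕ) (i j : Fin k) : rbase k n i j ∈ sympIdeal k n := by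
  rcases lt_trichotomy i j with h | rfl | h
  · exact Ideal.subset_span ⟨i, j, h, rfl⟩
  · simp [rbase]
  · have : rbase k n i j = -rbase k n j i := by
      simp [rbase]
    rw [this]
    exact neg_mem (Ideal.subset_span ⟨j, i, h, rfl⟩)

/-- The columns of the rows `ρ` of the generic matrix, modulo the ideal of the nullcone. -/
def nullconeColumn (k n : ℕ) {p : ℕ} (ρ : Fin p → Fin k) (j : Fin (2 * n)) (a : Fin p) :
    MvPolynomial (Fin k × Fin (2 * n)) ℂ ⧸ sympIdeal k n :=
  Ideal.Quotient.mk (sympIdeal k n) (MvPolynomial.X (ρ a, j))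

theorem columnMap_omegaW (k n : ℕ) {p : ℕ} (ρ : Fin p → Fin k) :
    columnMap (nullconeColumn k n ρ) (omegaW n) = 0 := by
  simp only [omegaW, map_sum, map_mul, columnMap_ι_single]
  refine sum_ι_mul_ι_eq_zero _ _ fun a b => ?_
  simp only [nullconeColumn, ← map_mul, ← map_sum]
  refine Ideal.Quotient.eq.mpr ?_
  have := rbase_mem_sympIdeal k n (ρ a) (ρ b)
  rwa [rbase, Finset.sum_sub_distrib] at this

theorem detCoeff_columnMap_eW (k n : ℕ) (I J : List ℕ) (hlen : J.length = I.length)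
    (ρ : Fin I.length → Fin k) (hρ : ∀ a, (ρ a : ℕ) = I.getD a 0 - 1)
    (hJ : ∀ x ∈ J, 1 ≤ x ∧ x ≤ 2 * n) :
    detCoeff _ I.length (columnMap (nullconeColumn k n ρ) (eW n J)) =
      Ideal.Quotient.mk (sympIdeal k n) (dmin k (2 * n) I J) := by
  have hb (b : Fin I.length) : J.getD b 0 - 1 < 2 * n := by
    have hlt : (b : ℕ) < J.length := b.isLt.trans_eq hlen.symm
    rw [List.getD_eq_getElem _ _ hlt]
    have := hJ _ (List.getElem_mem hlt)
    omega
  have heW : eW n J = (List.ofFn fun b : Fin I.length =>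
      ExteriorAlgebra.ι ℂ (Pi.single (⟨J.getD b 0 - 1, hb b⟩ : Fin (2 * n)) (1 : ℂ))).prod := by
    rw [eW]
    congr 1
    refine List.ext_getElem (by simp [hlen]) fun b h₁ h₂ => ?_
    have hbJ : b < J.length := by simpa using h₁
    have hlt := hb ⟨b, hbJ.trans_eq hlen⟩
    simp only [List.getD_eq_getElem _ _ hbJ] at hlt
    simp only [List.getElem_map, List.getElem_ofFn, List.getD_eq_getElem _ _ hbJ, dif_pos hlt]
  have hmulti : columnMap (nullconeColumn k n ρ) (eW n J) =
      ExteriorAlgebra.ιMulti _ I.length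
        fun b => nullconeColumn k n ρ ⟨J.getD b 0 - 1, hb b⟩ := by
    rw [heW, map_list_prod, List.map_ofFn, ExteriorAlgebra.ιMulti_apply]
    congr 2
    funext b
    exact columnMap_ι_single _ _
  rw [hmulti, detCoeff_ιMulti, dmin, RingHom.map_det, ← Matrix.det_transpose]
  congr 1
  ext a b
  have ha : I.getD a 0 - 1 < k := hρ a ▸ (ρ a).isLt
  have hρa : ρ a = ⟨I.getD a 0 - 1, ha⟩ := Fin.ext (hρ a)
  simp only [Matrix.transpose_apply, Matrix.of_apply, RingHom.mapMatrix_apply, Matrix.map_apply,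
    nullconeColumn, dif_pos (And.intro ha (hb b)), hρa]

theorem theta_subset_sympIdeal {k n p : ℕ} {S : Finset (List ℕ)} {c : List ℕ → ℂ}
    (hS : isOmegaSum n p S c) (I : List ℕ) (hI : ∀ x ∈ I, 1 ≤ x ∧ x ≤ k)
    (hp : I.length = p) : ∑ J ∈ S, c J • dmin k (2 * n) I J ∈ sympIdeal k n := by
  subst hp
  obtain ⟨-, hJ, x, -, hx⟩ := hS
  have ha (a : Fin I.length) : I.getD a 0 - 1 < k := by
    rw [List.getD_eq_getElem _ _ a.isLt]
    have := hI _ (List.getElem_mem a.isLt)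
    omega
  let ρ : Fin I.length → Fin k := fun a => ⟨I.getD a 0 - 1, ha a⟩
  have hzero := congrArg (fun y => detCoeff _ _ (columnMap (nullconeColumn k n ρ) y)) hx
  simp only [map_mul, columnMap_omegaW, zero_mul, map_zero, map_sum, map_smul] at hzero
  rw [← Ideal.Quotient.eq_zero_iff_mem, map_sum, ← hzero]
  refine Finset.sum_congr rfl fun J hJS => ?_
  rw [LinearMap.map_smul_of_tower,
    detCoeff_columnMap_eW k n I J (hJ J hJS).2.2 ρ (fun _ => rfl) (hJ J hJS).2.1]
  rfl

/-- The two-element index sequence `[2u-1, 2u]` (with `u` counted from `0`). -/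
def pairSeq (u : ℕ) : List ℕ := [2 * u + 1, 2 * u + 2]

theorem pairSeq_injective : Function.Injective pairSeq := fun u v h => by
  simp only [pairSeq, List.cons.injEq] at h
  omega

theorem isOmegaSum_pairSeq (n : ℕ) :
    isOmegaSum n 2 (Finset.univ.image fun u : Fin n => pairSeq u) (fun _ => 1) := by
  refine ⟨le_rfl, fun J hJ => ?_, 1, ?_, ?_⟩
  · obtain ⟨u, -, rfl⟩ := Finset.mem_image.mp hJ
    refine ⟨(by simp [pairSeq] : List.IsChain _ _), fun x hx => ?_, rfl⟩
    have := u.isLt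
    simp only [pairSeq, List.mem_cons, List.not_mem_nil, or_false] at hx
    omega
  · simp only [wedgePow, Nat.sub_self, pow_zero]
    exact Submodule.one_le.mp le_rfl
  · rw [Finset.sum_image fun u _ v _ h => Fin.ext (pairSeq_injective h), mul_one, omegaW]
    refine Finset.sum_congr rfl fun u _ => ?_
    have h₁ : 2 * u.1 < 2 * n := by have := u.isLt; omega
    have h₂ : 2 * u.1 + 1 < 2 * n := by have := u.isLt; omega
    simp [eW, pairSeq, h₁, h₂]

theorem dmin_pairSeq (k n : ℕ) (i j : Fin k) (u : Fin n) :
    dmin k (2 * n) [i + 1, j + 1] (pairSeq u) =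
      MvPolynomial.X (i, ⟨2 * u.1, by have := u.isLt; omega⟩) *
        MvPolynomial.X (j, ⟨2 * u.1 + 1, by have := u.isLt; omega⟩) -
      MvPolynomial.X (j, ⟨2 * u.1, by have := u.isLt; omega⟩) *
        MvPolynomial.X (i, ⟨2 * u.1 + 1, by have := u.isLt; omega⟩) := by
  have h₁ : 2 * u.1 < 2 * n := by have := u.isLt; omega
  have h₂ : 2 * u.1 + 1 < 2 * n := by have := u.isLt; omega
  refine (Matrix.det_fin_two _).trans ?_
  simp [pairSeq, h₁, h₂]
  ring

/-- The set
`Θ = {∑_d c_d δ_{[I:J_d]} : ∑_d c_d J_d an ω-sum of Sp_{2n}}` generates the ideal `I` of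
`ℂ[M_{k,2n}]` generated by the basic symplectic invariants `r_{ij}`. -/
theorem theta_generates_nullcone_ideal (k n : ℕ) (hk : 0 < k) (hn : 0 < n) :
    Ideal.span {f : MvPolynomial (Fin k × Fin (2 * n)) ℂ |
        ∃ (p : ℕ) (S : Finset (List ℕ)) (c : List ℕ → ℂ) (I : List ℕ),
          isOmegaSum n p S c ∧
          I.Chain' (· < ·) ∧ (∀ x ∈ I, 1 ≤ x ∧ x ≤ k) ∧ I.length = p ∧
          f = ∑ J ∈ S, c J • dmin k (2 * n) I J} =
      sympIdeal k n := by
  apply le_antisymm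
  · refine Ideal.span_le.mpr ?_
    rintro _ ⟨p, S, c, I, hS, -, hI, hp, rfl⟩
    exact theta_subset_sympIdeal hS I hI hp
  · refine Ideal.span_le.mpr ?_
    rintro _ ⟨i, j, hij, rfl⟩
    refine Ideal.subset_span ⟨2, _, fun _ => 1, [i + 1, j + 1], isOmegaSum_pairSeq n,
      ?_, ?_, rfl, ?_⟩
    · exact List.isChain_pair.mpr (by simpa using hij)
    · have := i.isLt
      have := j.isLt
      intro x hx
      simp only [List.mem_cons, List.not_mem_nil, or_false] at hx
      omega
    · rw [Finset.sum_image fun u _ v _ h => Fin.ext (pairSeq_injective h), rbase]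
      exact Finset.sum_congr rfl fun u _ => by rw [one_smul, dmin_pairSeq]

end
end

section
/- Let Σ_d c_d J_d be an ω-sum of Sp_{2n} with all coefficients c_d nonzero and the J_d distinct. Then the smallest element J_1 among {J_d} with respect to the lexicographic order satisfies J_1 ⋡ J̃. Conversely, for every J_1 ∈ L(2n,2n) with J_1 ⋡ J̃, there exists an ω-sum of Sp_{2n} whose lexicographically smallest term with nonzero coefficient is J_1. -/
noncomputable section

/-- `Jtilde n J` means `J ⪰ J̃ = [1,3,…,2n−1]`, i.e. `ℓ(J) ≤ n` and the `r`-th entry of `J`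
is at least `2r−1` (0-based: entry at index r is ≥ 2r+1). -/
def Jtilde (n : ℕ) (J : List ℕ) : Prop :=
  J.length ≤ n ∧ ∀ r < J.length, 2 * r + 1 ≤ J.getD r 0

/-- The exterior algebra of `ℂ^{2n}`. -/
abbrev ExtAlg (n : ℕ) := ExteriorAlgebra ℂ (Fin (2 * n) → ℂ)

/-- The degree one generator `e_j` (1-based; zero when `j > 2n`). -/
def gen (n j : ℕ) : ExtAlg n :=
  if h : j - 1 < 2 * n then
    ExteriorAlgebra.ι ℂ (Pi.single (⟨j - 1, h⟩ : Fin (2 * n)) 1)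
  else 0

/-- The monomial attached to a finite set of indices. -/
def eF (n : ℕ) (A : Finset ℕ) : ExtAlg n := eW n A.sort

/-- The `u`-th (0-based) pair `{2u+1, 2u+2}` of indices. -/
def pr (u : ℕ) : Finset ℕ := {2 * u + 1, 2 * u + 2}

lemma mem_pr {u x : ℕ} : x ∈ pr u ↔ x = 2 * u + 1 ∨ x = 2 * u + 2 := by
  simp [pr]

lemma mem_pr_iff {u x : ℕ} : x ∈ pr u ↔ 1 ≤ x ∧ u = (x - 1) / 2 := by
  rw [mem_pr]; omega

lemma card_pr (u : ℕ) : (pr u).card = 2 := by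
  simp [pr]

lemma disjoint_pr {u v : ℕ} (h : u ≠ v) : Disjoint (pr u) (pr v) := by
  rw [Finset.disjoint_left]
  intro x hx hy
  rw [mem_pr] at *
  omega

lemma eW_nil (n : ℕ) : eW n [] = 1 := by simp [eW]

lemma eW_cons (n j : ℕ) (J : List ℕ) : eW n (j :: J) = gen n j * eW n J := by
  simp [eW, gen]

lemma eW_append (n : ℕ) (J K : List ℕ) : eW n (J ++ K) = eW n J * eW n K := by
  simp [eW]

lemma gen_mem_range (n j : ℕ) : gen n j ∈ LinearMap.range (ExteriorAlgebra.ι ℂ :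
    (Fin (2 * n) → ℂ) →ₗ[ℂ] ExtAlg n) := by
  unfold gen
  split_ifs
  · exact LinearMap.mem_range_self _ _
  · exact Submodule.zero_mem _

lemma gen_mul_self (n j : ℕ) : gen n j * gen n j = 0 := by
  obtain ⟨x, hx⟩ := gen_mem_range n j
  rw [← hx, ExteriorAlgebra.ι_sq_zero]

lemma gen_mul_swap (n i j : ℕ) : gen n i * gen n j = -(gen n j * gen n i) := by
  obtain ⟨x, hx⟩ := gen_mem_range n i
  obtain ⟨y, hy⟩ := gen_mem_range n j
  rw [← hx, ← hy]
  exact eq_neg_of_add_eq_zero_left (ExteriorAlgebra.ι_add_mul_swap x y)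

lemma eW_mem_wedgePow (n : ℕ) (J : List ℕ) : eW n J ∈ wedgePow n J.length := by
  induction J with
  | nil => simp [eW_nil, wedgePow, Submodule.mem_one]
  | cons a J ih =>
    rw [eW_cons, List.length_cons, wedgePow, pow_succ']
    exact Submodule.mul_mem_mul (gen_mem_range n a) ih

lemma eW_perm (n : ℕ) {J K : List ℕ} (h : J.Perm K) : ∃ c : ℂ, c ≠ 0 ∧ eW n J = c • eW n K := by
  induction h with
  | nil => exact ⟨1, one_ne_zero, by simp⟩
  | cons a _ ih =>
    obtain ⟨c, hc, h⟩ := ih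
    exact ⟨c, hc, by rw [eW_cons, eW_cons, h, mul_smul_comm]⟩
  | swap a b l =>
    refine ⟨-1, by simp, ?_⟩
    rw [eW_cons, eW_cons, eW_cons, eW_cons, ← mul_assoc, ← mul_assoc, gen_mul_swap n b a]
    simp
  | trans _ _ ih₁ ih₂ =>
    obtain ⟨c, hc, h⟩ := ih₁
    obtain ⟨d, hd, h'⟩ := ih₂
    exact ⟨c * d, mul_ne_zero hc hd, by rw [h, h', mul_smul]⟩

lemma eW_eq_zero_of_not_nodup (n : ℕ) {J : List ℕ} (h : ¬ J.Nodup) : eW n J = 0 := by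
  rw [List.nodup_iff_sublist] at h
  push Not at h
  obtain ⟨a, ha⟩ := h
  obtain ⟨l, hl⟩ := ha.exists_perm_append
  obtain ⟨c, -, hc⟩ := eW_perm n hl
  rw [hc, eW_append, eW_cons, eW_cons, eW_nil, mul_one, gen_mul_self, zero_mul, smul_zero]

lemma eW_eq_smul_eF (n : ℕ) {J : List ℕ} (h : J.Nodup) :
    ∃ c : ℂ, c ≠ 0 ∧ eW n J = c • eF n J.toFinset := by
  apply eW_perm
  refine List.perm_of_nodup_nodup_toFinset_eq h (Finset.sort_nodup _ _) ?_
  rw [Finset.sort_toFinset]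

lemma eF_mul_eF (n : ℕ) {A B : Finset ℕ} (h : Disjoint A B) :
    ∃ c : ℂ, c ≠ 0 ∧ eF n A * eF n B = c • eF n (A ∪ B) := by
  have hnd : (A.sort ++ B.sort).Nodup := by
    rw [List.nodup_append']
    refine ⟨Finset.sort_nodup _ _, Finset.sort_nodup _ _, ?_⟩
    intro x hx hy
    rw [Finset.mem_sort] at hx hy
    exact Finset.disjoint_left.1 h hx hy
  obtain ⟨c, hc, h'⟩ := eW_eq_smul_eF n hnd
  refine ⟨c, hc, ?_⟩
  rw [eF, eF, ← eW_append, h', List.toFinset_append, Finset.sort_toFinset, Finset.sort_toFinset]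

lemma eF_mul_eF_of_not_disjoint (n : ℕ) {A B : Finset ℕ} (h : ¬ Disjoint A B) :
    eF n A * eF n B = 0 := by
  rw [eF, eF, ← eW_append]
  apply eW_eq_zero_of_not_nodup
  intro hnd
  rw [List.nodup_append'] at hnd
  apply h
  rw [Finset.disjoint_left]
  intro x hx hy
  exact hnd.2.2 ((Finset.mem_sort _).2 hx) ((Finset.mem_sort _).2 hy)

lemma eF_Icc_ne_zero (n : ℕ) : eF n (Finset.Icc 1 (2 * n)) ≠ 0 := by
  set L : List ℕ := List.ofFn fun i : Fin (2 * n) => (i : ℕ) + 1 with hL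
  have hnd : L.Nodup := by
    rw [hL, List.nodup_ofFn]
    intro i j hij
    ext
    simpa using hij
  have hF : L.toFinset = Finset.Icc 1 (2 * n) := by
    ext x
    simp only [hL, List.mem_toFinset, List.mem_ofFn, Finset.mem_Icc]
    constructor
    · rintro ⟨i, rfl⟩
      have := i.isLt
      omega
    · rintro ⟨h1, h2⟩
      exact ⟨⟨x - 1, by omega⟩, by simp; omega⟩
  obtain ⟨c, hc, h⟩ := eW_eq_smul_eF n hnd
  rw [hF] at h
  intro h0
  rw [h0, smul_zero] at h
  have key : eW n L = ExteriorAlgebra.ιMulti ℂ (2 * n)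
      (fun i => (Pi.single i 1 : Fin (2 * n) → ℂ)) := by
    rw [ExteriorAlgebra.ιMulti_apply, eW, hL, List.map_ofFn]
    congr 2
    funext i
    simp
  let f : ∀ i, (Fin (2 * n) → ℂ) [⋀^Fin i]→ₗ[ℂ] ℂ := fun i =>
    if hi : i = 2 * n then hi ▸ (Matrix.detRowAlternating : (Fin (2 * n) → ℂ) [⋀^Fin (2 * n)]→ₗ[ℂ] ℂ)
    else 0
  have h1 := ExteriorAlgebra.liftAlternating_apply_ιMulti f
    (fun i => (Pi.single i 1 : Fin (2 * n) → ℂ))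
  rw [← key, h, map_zero] at h1
  have h2 : (fun i => (Pi.single i 1 : Fin (2 * n) → ℂ)) = (1 : Matrix _ _ ℂ) := by
    funext i j
    simp [Matrix.one_apply, Pi.single_apply, eq_comm]
  simp only [f, dite_true] at h1
  rw [h2] at h1
  exact zero_ne_one (h1.trans (Matrix.det_one (n := Fin (2 * n)) (R := ℂ)))

lemma gen_mul_gen_mem_center (n i j : ℕ) :
    gen n i * gen n j ∈ Subalgebra.center ℂ (ExtAlg n) := by
  rw [Subalgebra.mem_center_iff]
  obtain ⟨x, hx⟩ := gen_mem_range n i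
  obtain ⟨y, hy⟩ := gen_mem_range n j
  have sw : ∀ a b : Fin (2 * n) → ℂ, ExteriorAlgebra.ι ℂ a * ExteriorAlgebra.ι ℂ b =
      -(ExteriorAlgebra.ι ℂ b * ExteriorAlgebra.ι ℂ a) := fun a b =>
    eq_neg_of_add_eq_zero_left (ExteriorAlgebra.ι_add_mul_swap a b)
  rw [← hx, ← hy]
  intro b
  induction b using ExteriorAlgebra.induction with
  | algebraMap r => exact Algebra.commutes _ _
  | ι z =>
    rw [← mul_assoc, sw z x, neg_mul, mul_assoc, sw z y, mul_neg, neg_neg, mul_assoc]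
  | mul a b ha hb => rw [mul_assoc, hb, ← mul_assoc, ha, mul_assoc]
  | add a b ha hb => rw [add_mul, mul_add, ha, hb]

/-- The central element `e_{2u+1} ∧ e_{2u+2}`. -/
def pairC (n u : ℕ) : Subalgebra.center ℂ (ExtAlg n) :=
  ⟨gen n (2 * u + 1) * gen n (2 * u + 2), gen_mul_gen_mem_center n _ _⟩

lemma coe_pairC (n u : ℕ) : (pairC n u : ExtAlg n) = eF n (pr u) := by
  have : (pr u).sort = [2 * u + 1, 2 * u + 2] := by
    rw [pr, Finset.sort_insert _ (by simp) (by simp), Finset.sort_singleton]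
  rw [eF, this, eW_cons, eW_cons, eW_nil, mul_one, pairC]

lemma pairC_mul_self (n u : ℕ) : pairC n u * pairC n u = 0 := by
  apply Subtype.ext
  push_cast
  rw [coe_pairC]
  apply eF_mul_eF_of_not_disjoint
  rw [disjoint_self]
  simp [pr]

lemma coe_center_comm (n : ℕ) (z : Subalgebra.center ℂ (ExtAlg n)) (a : ExtAlg n) :
    a * z = z * a := Subalgebra.mem_center_iff.1 z.2 a

lemma omegaW_eq (n : ℕ) :
    omegaW n = ((∑ u ∈ Finset.range n, pairC n u : Subalgebra.center ℂ (ExtAlg n)) : ExtAlg n) := by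
  push_cast
  rw [omegaW, Finset.sum_range]
  refine Finset.sum_congr rfl fun u _ => ?_
  have h1 : 2 * u.1 < 2 * n := by omega
  have h2 : 2 * u.1 + 1 < 2 * n := by omega
  simp [pairC, gen, h1, h2]

lemma eF_mul_prod_eq_zero (n : ℕ) {A U : Finset ℕ} {u : ℕ} (hu : u ∈ U)
    (h : ¬ Disjoint A (pr u)) :
    eF n A * ((∏ u ∈ U, pairC n u : Subalgebra.center ℂ (ExtAlg n)) : ExtAlg n) = 0 := by
  rw [← Finset.mul_prod_erase U _ hu]
  push_cast
  rw [← mul_assoc, coe_pairC, eF_mul_eF_of_not_disjoint n h, zero_mul]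

lemma eF_mul_prod (n : ℕ) {A U : Finset ℕ} (h : ∀ u ∈ U, Disjoint A (pr u)) :
    ∃ c : ℂ, c ≠ 0 ∧
      eF n A * ((∏ u ∈ U, pairC n u : Subalgebra.center ℂ (ExtAlg n)) : ExtAlg n) =
        c • eF n (A ∪ U.biUnion pr) := by
  induction U using Finset.induction_on generalizing A with
  | empty => exact ⟨1, one_ne_zero, by simp⟩
  | insert u U hu ih =>
    obtain ⟨c, hc, h1⟩ := eF_mul_eF n (h u (Finset.mem_insert_self _ _))
    obtain ⟨d, hd, h2⟩ := ih (A := A ∪ pr u) (by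
      intro v hv
      rw [Finset.disjoint_union_left]
      refine ⟨h v (Finset.mem_insert_of_mem hv), disjoint_pr ?_⟩
      rintro rfl
      exact hu hv)
    refine ⟨c * d, mul_ne_zero hc hd, ?_⟩
    rw [Finset.prod_insert hu, Subalgebra.coe_mul, ← mul_assoc, coe_pairC, h1, smul_mul_assoc, h2,
      smul_smul, Finset.biUnion_insert, Finset.union_assoc]

lemma sum_pow_of_mul_self_eq_zero {R ι : Type*} [CommRing R] [DecidableEq ι] (a : ι → R)
    (ha : ∀ i, a i * a i = 0) (s : Finset ι) (b : ℕ) :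
    (∑ i ∈ s, a i) ^ b = b.factorial * ∑ U ∈ s.powersetCard b, ∏ i ∈ U, a i := by
  induction s using Finset.induction_on generalizing b with
  | empty =>
    cases b with
    | zero => simp
    | succ b => rw [Finset.powersetCard_eq_empty.2 (by simp)]; simp
  | insert x s hx ih =>
    cases b with
    | zero => simp
    | succ b =>
      have key : (a x + ∑ i ∈ s, a i) ^ (b + 1) =
          (∑ i ∈ s, a i) ^ (b + 1) + (b + 1) * a x * (∑ i ∈ s, a i) ^ b := by
        generalize (∑ i ∈ s, a i) = y
        induction b with
        | zero => ring
        | succ b ihb =>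
          rw [pow_succ, ihb]
          push_cast
          linear_combination ((b : R) + 1) * y ^ b * ha x
      rw [Finset.sum_insert hx, key, ih, ih, Finset.powersetCard_succ_insert hx,
        Finset.sum_union, Finset.sum_image, mul_add]
      · congr 1
        rw [Nat.factorial_succ]
        push_cast
        have : ∑ U ∈ s.powersetCard b, ∏ i ∈ insert x U, a i =
            a x * ∑ U ∈ s.powersetCard b, ∏ i ∈ U, a i := by
          rw [Finset.mul_sum]
          refine Finset.sum_congr rfl fun U hU => Finset.prod_insert fun hxU =>
            hx ((Finset.mem_powersetCard.1 hU).1 hxU)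
        rw [this]
        ring
      · intro U hU V hV h
        have hU' : x ∉ U := fun hxU => hx ((Finset.mem_powersetCard.1 hU).1 hxU)
        have hV' : x ∉ V := fun hxU => hx ((Finset.mem_powersetCard.1 hV).1 hxU)
        rw [← Finset.erase_insert hU', ← Finset.erase_insert hV', h]
      · rw [Finset.disjoint_left]
        intro U hU hU'
        obtain ⟨V, -, rfl⟩ := Finset.mem_image.1 hU'
        exact hx ((Finset.mem_powersetCard.1 hU).1 (Finset.mem_insert_self _ _))

/-- The indices `u < m` whose pair is contained in `A`. -/
def fullP (A : Finset ℕ) (m : ℕ) : Finset ℕ := (Finset.range m).filter fun u => pr u ⊆ A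

/-- The indices `u < m` whose pair is disjoint from `A`. -/
def emptyP (A : Finset ℕ) (m : ℕ) : Finset ℕ := (Finset.range m).filter fun u => Disjoint (pr u) A

lemma mem_fullP {A : Finset ℕ} {m u : ℕ} : u ∈ fullP A m ↔ u < m ∧ pr u ⊆ A := by
  simp [fullP]

lemma mem_emptyP {A : Finset ℕ} {m u : ℕ} : u ∈ emptyP A m ↔ u < m ∧ Disjoint (pr u) A := by
  simp [emptyP]

lemma card_inter_Icc (A : Finset ℕ) (m : ℕ) :
    (A ∩ Finset.Icc 1 (2 * m)).card + (emptyP A m).card = m + (fullP A m).card := by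
  induction m with
  | zero => simp [emptyP, fullP]
  | succ m ih =>
    have h1 : A ∩ Finset.Icc 1 (2 * (m + 1)) = (A ∩ Finset.Icc 1 (2 * m)) ∪ (A ∩ pr m) := by
      ext x
      simp only [Finset.mem_inter, Finset.mem_union, Finset.mem_Icc, mem_pr]
      grind
    have h2 : Disjoint (A ∩ Finset.Icc 1 (2 * m)) (A ∩ pr m) := by
      rw [Finset.disjoint_left]
      intro x
      simp only [Finset.mem_inter, Finset.mem_Icc, mem_pr]
      omega
    rw [h1, Finset.card_union_of_disjoint h2]
    have h3 : (A ∩ pr m).card + (if Disjoint (pr m) A then 1 else 0) =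
        1 + (if pr m ⊆ A then 1 else 0) := by
      by_cases ha : 2 * m + 1 ∈ A <;> by_cases hb : 2 * m + 2 ∈ A <;>
        simp [pr, Finset.insert_subset_iff, Finset.inter_insert_of_mem,
          Finset.inter_insert_of_notMem, ha, hb]
    have h4 : (emptyP A (m + 1)).card =
        (emptyP A m).card + (if Disjoint (pr m) A then 1 else 0) := by
      unfold emptyP
      rw [Finset.range_add_one, Finset.filter_insert]
      split_ifs with h
      · rw [Finset.card_insert_of_notMem (by simp)]
      · rfl
    have h5 : (fullP A (m + 1)).card =
        (fullP A m).card + (if pr m ⊆ A then 1 else 0) := by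
      unfold fullP
      rw [Finset.range_add_one, Finset.filter_insert]
      split_ifs with h
      · rw [Finset.card_insert_of_notMem (by simp)]
      · rfl
    omega

lemma toFinset_sort_eq {J : List ℕ} (h : J.Pairwise (· < ·)) : J.toFinset.sort = J :=
  (List.toFinset_sort (· ≤ ·) h.nodup).2 (h.imp le_of_lt)

lemma card_toFinset_of_sorted {J : List ℕ} (h : J.Pairwise (· < ·)) :
    J.toFinset.card = J.length := List.toFinset_card_of_nodup h.nodup

lemma card_fullP_le_of_Jtilde {n : ℕ} {J : List ℕ} (hJ : Jtilde n J) (m : ℕ) :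
    (fullP J.toFinset m).card ≤ (emptyP J.toFinset m).card := by
  have key : (J.toFinset ∩ Finset.Icc 1 (2 * m)).card ≤ m := by
    calc (J.toFinset ∩ Finset.Icc 1 (2 * m)).card ≤ (J.take m).toFinset.card := by
          apply Finset.card_le_card
          intro x hx
          rw [Finset.mem_inter, List.mem_toFinset, Finset.mem_Icc] at hx
          obtain ⟨i, hi, rfl⟩ := List.mem_iff_getElem.1 hx.1
          have h1 := hJ.2 i hi
          rw [List.getD_eq_getElem _ _ hi] at h1
          rw [List.mem_toFinset, List.mem_take_iff_getElem]
          exact ⟨i, by omega, rfl⟩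
      _ ≤ (J.take m).length := List.toFinset_card_le _
      _ ≤ m := by simp
  have := card_inter_Icc J.toFinset m
  omega

lemma exists_card_emptyP_lt {n : ℕ} {J : List ℕ} (hs : J.Pairwise (· < ·))
    (hb : ∀ x ∈ J, 1 ≤ x ∧ x ≤ 2 * n) (hJ : ¬ Jtilde n J) :
    ∃ m ≤ n, (emptyP J.toFinset m).card < (fullP J.toFinset m).card := by
  suffices ∃ m ≤ n, m < (J.toFinset ∩ Finset.Icc 1 (2 * m)).card by
    obtain ⟨m, hm, h⟩ := this
    have := card_inter_Icc J.toFinset m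
    exact ⟨m, hm, by omega⟩
  by_cases hl : J.length ≤ n
  · simp only [Jtilde, hl, true_and] at hJ
    push Not at hJ
    obtain ⟨r, hr, h⟩ := hJ
    rw [List.getD_eq_getElem _ _ hr] at h
    refine ⟨r, by omega, ?_⟩
    have h1 : (J.take (r + 1)).toFinset.card = r + 1 := by
      rw [List.toFinset_card_of_nodup (hs.nodup.sublist (List.take_sublist _ _)), List.length_take]
      omega
    have h2 : (J.take (r + 1)).toFinset ⊆ J.toFinset ∩ Finset.Icc 1 (2 * r) := by
      intro x hx
      rw [List.mem_toFinset, List.mem_take_iff_getElem] at hx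
      obtain ⟨i, hi, rfl⟩ := hx
      have hi' : i < J.length := by omega
      have hle : J[i] ≤ J[r] := by
        rcases Nat.lt_or_ge i r with h' | h'
        · exact (List.pairwise_iff_getElem.1 hs i r hi' hr h').le
        · have : i = r := by omega
          subst this
          rfl
      rw [Finset.mem_inter, List.mem_toFinset, Finset.mem_Icc]
      exact ⟨List.getElem_mem _, (hb _ (List.getElem_mem _)).1, by omega⟩
    have := Finset.card_le_card h2
    omega
  · refine ⟨n, le_rfl, ?_⟩
    rw [Finset.inter_eq_left.2, card_toFinset_of_sorted hs]
    · omega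
    · intro x hx
      rw [List.mem_toFinset] at hx
      exact Finset.mem_Icc.2 (hb x hx)

lemma exists_first_difference {J K : List ℕ} (h : List.Lex (· < ·) J K)
    (hl : J.length = K.length) (hJ : J.Pairwise (· < ·)) (hK : K.Pairwise (· < ·)) :
    ∃ t ∈ J, t ∉ K ∧ ∀ x < t, x ∈ J ↔ x ∈ K := by
  induction h with
  | nil => simp at hl
  | cons h ih =>
    rw [List.pairwise_cons] at hJ hK
    obtain ⟨t, ht, ht', ht''⟩ := ih (by simpa using hl) hJ.2 hK.2
    have := hJ.1 t ht
    refine ⟨t, List.mem_cons_of_mem _ ht, ?_, ?_⟩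
    · simp [ht', this.ne']
    · intro x hx
      simp [ht'' x hx]
  | rel h =>
    rename_i a J b K
    rw [List.pairwise_cons] at hJ hK
    refine ⟨a, by simp, ?_, ?_⟩
    · intro ha
      rcases List.mem_cons.1 ha with rfl | ha
      · omega
      · have := hK.1 a ha
        omega
    · intro x hx
      constructor
      · intro h'
        rcases List.mem_cons.1 h' with rfl | h'
        · omega
        · have := hJ.1 x h'
          omega
      · intro h'
        rcases List.mem_cons.1 h' with rfl | h'
        · omega
        · have := hK.1 x h'
          omega

lemma lex_of_first_difference {J K : List ℕ} (hl : J.length = K.length)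
    (hJ : J.Pairwise (· < ·)) (hK : K.Pairwise (· < ·)) {t : ℕ} (ht : t ∈ J) (ht' : t ∉ K)
    (hx : ∀ x < t, x ∈ J ↔ x ∈ K) : List.Lex (· < ·) J K := by
  by_contra h
  have hne : J ≠ K := by
    rintro rfl
    exact ht' ht
  have h' : List.Lex (· < ·) K J := by
    rcases lt_trichotomy J K with h1 | h1 | h1
    · exact absurd h1 h
    · exact absurd h1 hne
    · exact h1
  obtain ⟨s, hs, hs', hs''⟩ := exists_first_difference h' hl.symm hK hJ
  rcases lt_trichotomy s t with h1 | rfl | h1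
  · exact hs' ((hx s h1).2 hs)
  · exact ht' hs
  · exact ht' ((hs'' t h1).2 ht)

lemma exists_matching (A : Finset ℕ) (n : ℕ)
    (h : ∀ m, (fullP A m).card ≤ (emptyP A m).card) :
    ∃ e : ℕ → ℕ, Set.InjOn e (fullP A n) ∧ ∀ k ∈ fullP A n, e k < k ∧ e k ∈ emptyP A n := by
  have hall := (Finset.all_card_le_biUnion_card_iff_exists_injective
    (fun k : fullP A n => emptyP A k)).1 (by
      intro s
      rcases s.eq_empty_or_nonempty with rfl | hs
      · simp
      · obtain ⟨M, hM, hmax⟩ := s.exists_max_image (fun k => (k : ℕ)) hs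
        have hMf := mem_fullP.1 M.2
        calc s.card = (s.map (Function.Embedding.subtype _)).card := (Finset.card_map _).symm
          _ ≤ (fullP A (M + 1)).card := by
            apply Finset.card_le_card
            intro x hx
            obtain ⟨y, hy, rfl⟩ := Finset.mem_map.1 hx
            exact mem_fullP.2 ⟨Nat.lt_succ_of_le (hmax y hy), (mem_fullP.1 y.2).2⟩
          _ ≤ (emptyP A (M + 1)).card := h _
          _ ≤ (emptyP A M).card := by
            apply Finset.card_le_card
            intro x hx
            rw [mem_emptyP] at hx ⊢
            refine ⟨lt_of_le_of_ne (Nat.le_of_lt_succ hx.1) ?_, hx.2⟩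
            rintro rfl
            have h1 : 2 * (M : ℕ) + 1 ∈ pr M := mem_pr.2 (Or.inl rfl)
            exact Finset.disjoint_left.1 hx.2 h1 (hMf.2 h1)
          _ ≤ _ := Finset.card_le_card (Finset.subset_biUnion_of_mem
            (fun k : fullP A n => emptyP A k) hM))
  obtain ⟨f, hf, hf'⟩ := hall
  refine ⟨fun k => if hk : k ∈ fullP A n then f ⟨k, hk⟩ else 0, ?_, ?_⟩
  · intro a ha b hb hab
    rw [Finset.mem_coe] at ha hb
    simp only [ha, hb, dite_true] at hab
    simpa using hf hab
  · intro k hk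
    simp only [hk, dite_true]
    have h1 := mem_emptyP.1 (hf' ⟨k, hk⟩)
    have h2 := mem_fullP.1 hk
    exact ⟨h1.1, mem_emptyP.2 ⟨h1.1.trans h2.1, h1.2⟩⟩

/-- The indices outside `A` whose pair meets `A`. -/
def singleCompl (A : Finset ℕ) (n : ℕ) : Finset ℕ :=
  (Finset.Icc 1 (2 * n) \ A) \ (emptyP A n).biUnion pr

/-- The central factor of the annihilator of `ω` attached to a matching `e` of the full pairs
of `A` with empty pairs. -/
def matchingC (A : Finset ℕ) (n : ℕ) (e : ℕ → ℕ) : Subalgebra.center ℂ (ExtAlg n) :=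
  (∏ k ∈ fullP A n, (pairC n k - pairC n (e k))) *
    ∏ u ∈ emptyP A n \ (fullP A n).image e, pairC n u

lemma add_mul_sub_mul_eq_zero {R : Type*} [CommRing R] {a b : R} (ha : a * a = 0)
    (hb : b * b = 0) (x y : R) : (a + b) * ((a - b) * x * y) = 0 := by
  linear_combination x * y * (ha - hb)

lemma eF_mul_omega_mul_matchingC (A : Finset ℕ) (n : ℕ) (e : ℕ → ℕ)
    (he : Set.InjOn e (fullP A n)) (he' : ∀ k ∈ fullP A n, e k ∈ emptyP A n) :
    eF n (singleCompl A n) *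
      (((∑ u ∈ Finset.range n, pairC n u) * matchingC A n e : Subalgebra.center ℂ (ExtAlg n)) :
        ExtAlg n) = 0 := by
  have hdisj : Disjoint (fullP A n) (emptyP A n) := by
    rw [Finset.disjoint_left]
    intro u hu hu'
    have h1 : 2 * u + 1 ∈ pr u := mem_pr.2 (Or.inl rfl)
    exact Finset.disjoint_left.1 (mem_emptyP.1 hu').2 h1 ((mem_fullP.1 hu).2 h1)
  have hsub : fullP A n ∪ emptyP A n ⊆ Finset.range n :=
    Finset.union_subset (Finset.filter_subset _ _) (Finset.filter_subset _ _)
  have himg : (fullP A n).image e ⊆ emptyP A n := Finset.image_subset_iff.2 he'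
  have hsum : ∑ u ∈ Finset.range n, pairC n u =
      ∑ u ∈ Finset.range n \ (fullP A n ∪ emptyP A n), pairC n u +
      (∑ k ∈ fullP A n, (pairC n k + pairC n (e k)) +
        ∑ u ∈ emptyP A n \ (fullP A n).image e, pairC n u) := by
    rw [← Finset.sum_sdiff hsub, Finset.sum_union hdisj, ← Finset.sum_sdiff himg,
      Finset.sum_image he, Finset.sum_add_distrib]
    ring
  have h1 : (∑ k ∈ fullP A n, (pairC n k + pairC n (e k))) * matchingC A n e = 0 := by
    rw [Finset.sum_mul]
    refine Finset.sum_eq_zero fun k hk => ?_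
    rw [matchingC, ← Finset.mul_prod_erase _ _ hk]
    exact add_mul_sub_mul_eq_zero (pairC_mul_self n k) (pairC_mul_self n (e k)) _ _
  have h2 : (∑ u ∈ emptyP A n \ (fullP A n).image e, pairC n u) * matchingC A n e = 0 := by
    rw [Finset.sum_mul]
    refine Finset.sum_eq_zero fun u hu => ?_
    rw [matchingC, ← Finset.mul_prod_erase _ _ hu]
    rw [mul_left_comm, ← mul_assoc (pairC n u), pairC_mul_self, zero_mul, mul_zero]
  rw [hsum, add_mul, add_mul, h1, h2, add_zero, add_zero, Subalgebra.coe_mul, ← mul_assoc]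
  push_cast
  rw [Finset.mul_sum, Finset.sum_eq_zero, zero_mul]
  intro u hu
  rw [coe_pairC]
  apply eF_mul_eF_of_not_disjoint
  rw [Finset.mem_sdiff, Finset.mem_union, not_or, Finset.mem_range] at hu
  obtain ⟨hun, hu1, hu2⟩ := hu
  have h3 : ¬ pr u ⊆ A := fun h => hu1 (mem_fullP.2 ⟨hun, h⟩)
  obtain ⟨x, hx, hxA⟩ := Finset.not_subset.1 h3
  rw [Finset.not_disjoint_iff]
  refine ⟨x, ?_, hx⟩
  rw [singleCompl, Finset.mem_sdiff, Finset.mem_sdiff, Finset.mem_Icc]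
  refine ⟨⟨?_, hxA⟩, ?_⟩
  · rw [mem_pr] at hx
    omega
  · intro h
    obtain ⟨v, hv, hxv⟩ := Finset.mem_biUnion.1 h
    rw [mem_pr_iff] at hx hxv
    rw [hxv.2, ← hx.2] at hv
    exact hu2 hv

lemma eF_mul_prod_sub (n : ℕ) (C F : Finset ℕ) (e : ℕ → ℕ)
    (h : ∀ k ∈ F, ¬ Disjoint C (pr k)) :
    eF n C * ((∏ k ∈ F, (pairC n k - pairC n (e k)) : Subalgebra.center ℂ (ExtAlg n)) :
      ExtAlg n) = (-1 : ℂ) ^ F.card •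
        (eF n C * ((∏ k ∈ F, pairC n (e k) : Subalgebra.center ℂ (ExtAlg n)) : ExtAlg n)) := by
  induction F using Finset.induction_on with
  | empty => simp
  | insert k F hk ih =>
    have h0 : eF n C * (pairC n k : ExtAlg n) = 0 := by
      rw [coe_pairC, eF_mul_eF_of_not_disjoint n (h k (Finset.mem_insert_self _ _))]
    have ih' := ih fun k hk => h k (Finset.mem_insert_of_mem hk)
    rw [Finset.prod_insert hk, Finset.prod_insert hk, Finset.card_insert_of_notMem hk]
    generalize (∏ k ∈ F, (pairC n k - pairC n (e k))) = P at ih' ⊢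
    generalize (∏ k ∈ F, pairC n (e k)) = Q at ih' ⊢
    rw [Subalgebra.coe_mul, Subalgebra.coe_mul, ← mul_assoc, ← mul_assoc, Subalgebra.coe_sub,
      mul_sub, h0, zero_sub, neg_mul, coe_center_comm n (pairC n (e k)), mul_assoc, mul_assoc,
      ih', mul_smul_comm, pow_succ, mul_neg_one, neg_smul]

lemma eF_mul_singleCompl_mul_matchingC_ne_zero {A : Finset ℕ} {n : ℕ} {e : ℕ → ℕ}
    (hA : A ⊆ Finset.Icc 1 (2 * n))
    (he : Set.InjOn e (fullP A n)) (he' : ∀ k ∈ fullP A n, e k ∈ emptyP A n) :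
    eF n A * (eF n (singleCompl A n) * (matchingC A n e : ExtAlg n)) ≠ 0 := by
  have himg : (fullP A n).image e ⊆ emptyP A n := Finset.image_subset_iff.2 he'
  have hd : Disjoint A (singleCompl A n) := by
    rw [Finset.disjoint_left]
    intro x hx hx'
    simp [singleCompl, hx] at hx'
  obtain ⟨c, hc, h1⟩ := eF_mul_eF n hd
  have h2 := eF_mul_prod_sub n (A ∪ singleCompl A n) (fullP A n) e (by
    intro k hk
    rw [Finset.not_disjoint_iff]
    have h1 : 2 * k + 1 ∈ pr k := mem_pr.2 (Or.inl rfl)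
    exact ⟨2 * k + 1, Finset.mem_union_left _ ((mem_fullP.1 hk).2 h1), h1⟩)
  obtain ⟨d, hd, h3⟩ := eF_mul_prod n (A := A ∪ singleCompl A n) (U := emptyP A n) (by
    intro u hu
    rw [Finset.disjoint_union_left]
    refine ⟨(mem_emptyP.1 hu).2.symm, ?_⟩
    rw [Finset.disjoint_left]
    intro x hx hxu
    exact (Finset.mem_sdiff.1 hx).2 (Finset.mem_biUnion.2 ⟨u, hu, hxu⟩))
  have h4 : A ∪ singleCompl A n ∪ (emptyP A n).biUnion pr = Finset.Icc 1 (2 * n) := by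
    have h5 : (emptyP A n).biUnion pr ⊆ Finset.Icc 1 (2 * n) := by
      intro x hx
      obtain ⟨u, hu, hxu⟩ := Finset.mem_biUnion.1 hx
      have := (mem_emptyP.1 hu).1
      rw [mem_pr] at hxu
      rw [Finset.mem_Icc]
      omega
    ext x
    have := @hA x
    have := @h5 x
    simp only [singleCompl, Finset.mem_union, Finset.mem_sdiff]
    tauto
  have hprod : (∏ k ∈ fullP A n, pairC n (e k)) *
      ∏ u ∈ emptyP A n \ (fullP A n).image e, pairC n u = ∏ u ∈ emptyP A n, pairC n u := by
    rw [← Finset.prod_sdiff himg, Finset.prod_image he]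
    exact mul_comm _ _
  rw [matchingC, Subalgebra.coe_mul, ← mul_assoc, ← mul_assoc, h1, smul_mul_assoc, h2,
    smul_mul_assoc, smul_mul_assoc, mul_assoc, ← Subalgebra.coe_mul, hprod, h3, h4]
  exact smul_ne_zero hc (smul_ne_zero (by simp) (smul_ne_zero hd (eF_Icc_ne_zero n)))

lemma eF_mul_mul_eq_zero_of_dvd (n : ℕ) (B Q : Finset ℕ)
    {z w : Subalgebra.center ℂ (ExtAlg n)} (hzw : z ∣ w) (hz : eF n B * (z : ExtAlg n) = 0) :
    eF n B * (eF n Q * (w : ExtAlg n)) = 0 := by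
  obtain ⟨y, rfl⟩ := hzw
  rw [Subalgebra.coe_mul, ← mul_assoc (eF n Q), coe_center_comm n z, mul_assoc (z : ExtAlg n),
    ← mul_assoc, hz, zero_mul]

lemma eF_mul_singleCompl_mul_matchingC_eq_zero {A B : Finset ℕ} {n : ℕ} {e : ℕ → ℕ}
    (hB : B ⊆ Finset.Icc 1 (2 * n)) (hcard : B.card = A.card)
    (he' : ∀ k ∈ fullP A n, e k < k ∧ e k ∈ emptyP A n) {t : ℕ} (ht : t ∈ A) (htB : t ∉ B) (hlt : ∀ x < t, x ∈ A ↔ x ∈ B) :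
    eF n B * (eF n (singleCompl A n) * (matchingC A n e : ExtAlg n)) = 0 := by
  by_cases hQ : Disjoint B (singleCompl A n)
  swap
  · rw [← mul_assoc, eF_mul_eF_of_not_disjoint n hQ, zero_mul]
  by_cases hG : ∃ u ∈ emptyP A n \ (fullP A n).image e, ¬ Disjoint B (pr u)
  · obtain ⟨u, hu, hBu⟩ := hG
    refine eF_mul_mul_eq_zero_of_dvd n B _
      (Dvd.dvd.mul_left (Finset.dvd_prod_of_mem (pairC n) hu) _) ?_
    rw [coe_pairC, eF_mul_eF_of_not_disjoint n hBu]
  by_cases hF : ∃ k ∈ fullP A n, ¬ Disjoint B (pr k) ∧ ¬ Disjoint B (pr (e k))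
  · obtain ⟨k, hk, hBk, hBe⟩ := hF
    refine eF_mul_mul_eq_zero_of_dvd n B _
      (Dvd.dvd.mul_right (Finset.dvd_prod_of_mem (fun k => pairC n k - pairC n (e k)) hk) _) ?_
    rw [Subalgebra.coe_sub, coe_pairC, coe_pairC, mul_sub, eF_mul_eF_of_not_disjoint n hBk,
      eF_mul_eF_of_not_disjoint n hBe, sub_zero]
  exfalso
  push Not at hG hF
  -- every element of `B \ A` lies in the pair matched to a full pair of `A`
  have hex : ∀ x ∈ B, x ∉ A → ∃ k ∈ fullP A n, x ∈ pr (e k) := by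
    intro x hx hxA
    have h1 : x ∈ (emptyP A n).biUnion pr := by
      by_contra h
      exact Finset.disjoint_left.1 hQ hx
        (Finset.mem_sdiff.2 ⟨Finset.mem_sdiff.2 ⟨hB hx, hxA⟩, h⟩)
    obtain ⟨u, hu, hxu⟩ := Finset.mem_biUnion.1 h1
    by_cases hui : u ∈ (fullP A n).image e
    · obtain ⟨k, hk, rfl⟩ := Finset.mem_image.1 hui
      exact ⟨k, hk, hxu⟩
    · exact absurd hxu (Finset.disjoint_left.1 (hG u (Finset.mem_sdiff.2 ⟨hu, hui⟩)) hx)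
  choose! κ hκ hκ' using hex
  have hfull : ∀ x ∈ B, x ∉ A → ∀ y ∈ pr (κ x), y ∉ B := by
    intro x hx hxA y hy hyB
    have h1 := hF (κ x) (hκ x hx hxA) (by
      rw [Finset.not_disjoint_iff]
      exact ⟨y, hyB, hy⟩)
    exact Finset.disjoint_left.1 h1 hx (hκ' x hx hxA)
  let g : ℕ → ℕ := fun x => if x ∈ A then x else x + 2 * κ x - 2 * e (κ x)
  have hg : ∀ x ∈ B, x ∉ A → g x ∈ pr (κ x) := by
    intro x hx hxA
    have h1 := hκ' x hx hxA
    have h2 := (he' _ (hκ x hx hxA)).1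
    rw [mem_pr] at h1 ⊢
    simp only [g, hxA, if_false]
    omega
  have hmaps : ∀ x ∈ B, g x ∈ A.erase t := by
    intro x hx
    by_cases hxA : x ∈ A
    · simp only [g, hxA, if_true]
      rw [Finset.mem_erase]
      exact ⟨fun h => htB (h ▸ hx), hxA⟩
    · rw [Finset.mem_erase]
      refine ⟨?_, (mem_fullP.1 (hκ x hx hxA)).2 (hg x hx hxA)⟩
      intro hgt
      have h1 := hg x hx hxA
      have h2 := (he' _ (hκ x hx hxA)).1
      have h3 := hκ' x hx hxA
      rw [hgt] at h1
      rw [mem_pr] at h1 h3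
      exact hxA ((hlt x (by omega)).2 hx)
  have hinj : Set.InjOn g B := by
    intro x hx y hy hxy
    rw [Finset.mem_coe] at hx hy
    by_cases hxA : x ∈ A <;> by_cases hyA : y ∈ A
    · simpa [g, hxA, hyA] using hxy
    · have h1 := hg y hy hyA
      rw [← hxy] at h1
      simp only [g, hxA, if_true] at h1
      exact absurd hx (hfull y hy hyA x h1)
    · have h1 := hg x hx hxA
      rw [hxy] at h1
      simp only [g, hyA, if_true] at h1
      exact absurd hy (hfull x hx hxA y h1)
    · have h1 := hg x hx hxA
      have h2 := hg y hy hyA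
      have hk : κ x = κ y := by
        rw [hxy] at h1
        rw [mem_pr] at h1 h2
        omega
      have h3 := (he' _ (hκ x hx hxA)).1
      simp only [g, hxA, hyA, if_false, hk] at hxy
      rw [hk] at h3
      omega
  have h1 := Finset.card_le_card_of_injOn g hmaps hinj
  rw [Finset.card_erase_of_mem ht] at h1
  have h2 := Finset.card_pos.2 ⟨t, ht⟩
  omega

lemma not_Jtilde_of_isOmegaSum {n p : ℕ} {S : Finset (List ℕ)} {c : List ℕ → ℂ}
    (h : isOmegaSum n p S c) (hc : ∀ J ∈ S, c J ≠ 0) {J₁ : List ℕ} (hJ₁ : J₁ ∈ S)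
    (hmin : ∀ J ∈ S, J ≠ J₁ → List.Lex (· < ·) J₁ J) : ¬ Jtilde n J₁ := by
  intro hJ
  obtain ⟨-, hS, x, -, hx⟩ := h
  have hs : ∀ J ∈ S, J.Pairwise (· < ·) := fun J hJ => List.isChain_iff_pairwise.1 (hS J hJ).1
  have heW : ∀ J ∈ S, eW n J = eF n J.toFinset := fun J hJ => by
    rw [eF, toFinset_sort_eq (hs J hJ)]
  have hIcc : ∀ J ∈ S, J.toFinset ⊆ Finset.Icc 1 (2 * n) := fun J hJ x hx =>
    Finset.mem_Icc.2 ((hS J hJ).2.1 x (List.mem_toFinset.1 hx))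
  obtain ⟨e, he, he'⟩ := exists_matching J₁.toFinset n (card_fullP_le_of_Jtilde hJ)
  have h1 := eF_mul_omega_mul_matchingC J₁.toFinset n e he fun k hk => (he' k hk).2
  have h2 : (∑ J ∈ S, c J • eW n J) *
      (eF n (singleCompl J₁.toFinset n) * (matchingC J₁.toFinset n e : ExtAlg n)) = 0 := by
    rw [hx, omegaW_eq, ← coe_center_comm, mul_assoc, ← mul_assoc _ (eF n _),
      ← coe_center_comm n _ (eF n _), mul_assoc, ← Subalgebra.coe_mul, h1, mul_zero]
  rw [Finset.sum_mul, Finset.sum_eq_single_of_mem J₁ hJ₁, heW J₁ hJ₁, smul_mul_assoc] at h2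
  · exact smul_ne_zero (hc J₁ hJ₁) (eF_mul_singleCompl_mul_matchingC_ne_zero (hIcc J₁ hJ₁) he
      fun k hk => (he' k hk).2) h2
  · intro J hJS hne
    have hlen : J₁.length = J.length := (hS J₁ hJ₁).2.2.trans (hS J hJS).2.2.symm
    obtain ⟨t, ht, ht', hlt⟩ := exists_first_difference (hmin J hJS hne) hlen (hs _ hJ₁) (hs _ hJS)
    rw [heW J hJS, smul_mul_assoc, eF_mul_singleCompl_mul_matchingC_eq_zero (hIcc J hJS)
      (by rw [card_toFinset_of_sorted (hs _ hJS), card_toFinset_of_sorted (hs _ hJ₁), hlen])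
      he' (List.mem_toFinset.2 ht) (fun h => ht' (List.mem_toFinset.1 h))
      (fun x hx => by rw [List.mem_toFinset, List.mem_toFinset]; exact hlt x hx), smul_zero]

lemma eF_mem_wedgePow (n : ℕ) (A : Finset ℕ) : eF n A ∈ wedgePow n A.card := by
  have := eW_mem_wedgePow n A.sort
  rwa [Finset.length_sort] at this

lemma mul_mem_wedgePow {n p q : ℕ} {x y : ExtAlg n} (hx : x ∈ wedgePow n p)
    (hy : y ∈ wedgePow n q) : x * y ∈ wedgePow n (p + q) := by
  rw [wedgePow, pow_add]
  exact Submodule.mul_mem_mul hx hy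

lemma pow_mem_wedgePow {n p : ℕ} {x : ExtAlg n} (hx : x ∈ wedgePow n p) (i : ℕ) :
    x ^ i ∈ wedgePow n (p * i) := by
  rw [wedgePow, pow_mul]
  exact Submodule.pow_mem_pow _ hx i

lemma sum_pairC_mem_wedgePow (n : ℕ) (s : Finset ℕ) :
    ((∑ u ∈ s, pairC n u : Subalgebra.center ℂ (ExtAlg n)) : ExtAlg n) ∈ wedgePow n 2 := by
  push_cast
  refine Submodule.sum_mem _ fun u _ => ?_
  have := eF_mem_wedgePow n (pr u)
  rwa [card_pr, ← coe_pairC] at this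

lemma card_union_biUnion_pr {R U : Finset ℕ} (h : ∀ u ∈ U, Disjoint R (pr u)) :
    (R ∪ U.biUnion pr).card = R.card + 2 * U.card := by
  rw [Finset.card_union_of_disjoint ((Finset.disjoint_biUnion_right _ _ _).2 h),
    Finset.card_biUnion fun u _ v _ huv => disjoint_pr huv]
  simp [card_pr, mul_comm]

lemma neg_pow_eq_zero {R : Type*} [CommRing R] {x : R} {b : ℕ} (h : x ^ b = 0) :
    (-x) ^ b = 0 := by
  rw [neg_pow, h, mul_zero]

lemma exists_omegaW_mul_eq (n : ℕ) (R E : Finset ℕ) (hE : E ⊆ Finset.range n) (b : ℕ)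
    (hb : E.card < b) :
    ∃ x ∈ wedgePow n (R.card + 2 * (b - 1)), omegaW n * x =
      eF n R * (((∑ u ∈ Finset.range n \ E, pairC n u) ^ b : Subalgebra.center ℂ (ExtAlg n)) :
        ExtAlg n) := by
  have hτ : (-∑ u ∈ E, pairC n u) ^ b = 0 := by
    apply neg_pow_eq_zero
    rw [sum_pow_of_mul_self_eq_zero _ (pairC_mul_self n),
      Finset.powersetCard_eq_empty.2 hb, Finset.sum_empty, mul_zero]
  have hsum : ∑ u ∈ Finset.range n, pairC n u =
      ∑ u ∈ Finset.range n \ E, pairC n u - -∑ u ∈ E, pairC n u := by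
    rw [sub_neg_eq_add, Finset.sum_sdiff hE]
  have hσ := sum_pairC_mem_wedgePow n (Finset.range n \ E)
  have hτ' := sum_pairC_mem_wedgePow n E
  rw [omegaW_eq, hsum]
  generalize (∑ u ∈ Finset.range n \ E, pairC n u) = σ at *
  generalize (∑ u ∈ E, pairC n u) = τ at *
  have hgeom := (Commute.all σ (-τ)).geom_sum₂_mul b
  rw [hτ, sub_zero] at hgeom
  refine ⟨eF n R * ((∑ i ∈ Finset.range b, σ ^ i * (-τ) ^ (b - 1 - i) :
    Subalgebra.center ℂ (ExtAlg n)) : ExtAlg n), ?_, ?_⟩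
  · refine mul_mem_wedgePow (eF_mem_wedgePow n R) ?_
    push_cast
    refine Submodule.sum_mem _ fun i hi => ?_
    have h1 : 2 * (b - 1) = 2 * i + 2 * (b - 1 - i) := by
      have := Finset.mem_range.1 hi
      omega
    rw [h1]
    exact mul_mem_wedgePow (pow_mem_wedgePow hσ i)
      (pow_mem_wedgePow (Submodule.neg_mem _ hτ') _)
  · rw [← coe_center_comm, mul_assoc, ← Subalgebra.coe_mul, hgeom]

lemma exists_isOmegaSum {n : ℕ} {J₁ : List ℕ} (hs : J₁.Pairwise (· < ·))
    (hb : ∀ x ∈ J₁, 1 ≤ x ∧ x ≤ 2 * n) (hJ : ¬ Jtilde n J₁) :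
    ∃ (p : ℕ) (S : Finset (List ℕ)) (c : List ℕ → ℂ),
      isOmegaSum n p S c ∧ (∀ J ∈ S, c J ≠ 0) ∧ J₁ ∈ S ∧
        ∀ J ∈ S, J ≠ J₁ → List.Lex (· < ·) J₁ J := by
  obtain ⟨m, hm, hlt⟩ := exists_card_emptyP_lt hs hb hJ
  set A := J₁.toFinset with hA
  set F := fullP A m with hF
  set E := emptyP A m with hE
  set b := F.card with hb'
  set R := A \ F.biUnion pr with hR
  have hEn : E ⊆ Finset.range n := fun u hu =>
    Finset.mem_range.2 ((mem_emptyP.1 hu).1.trans_le hm)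
  have hAIcc : A ⊆ Finset.Icc 1 (2 * n) := fun x hx =>
    Finset.mem_Icc.2 (hb x (List.mem_toFinset.1 hx))
  have hFA : F.biUnion pr ⊆ A := Finset.biUnion_subset.2 fun u hu => (mem_fullP.1 hu).2
  have hRF : R ∪ F.biUnion pr = A := Finset.sdiff_union_of_subset hFA
  have hRdF : ∀ u ∈ F, Disjoint R (pr u) := fun u hu =>
    Finset.disjoint_of_subset_right (Finset.subset_biUnion_of_mem pr hu) Finset.sdiff_disjoint
  obtain ⟨x, hx, hωx⟩ := exists_omegaW_mul_eq n R E hEn b hlt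
  set T := ((Finset.range n \ E).powersetCard b).filter fun U => ∀ u ∈ U, Disjoint R (pr u) with hT
  have hmemT : ∀ U ∈ T, U ⊆ Finset.range n \ E ∧ U.card = b ∧ ∀ u ∈ U, Disjoint R (pr u) := by
    intro U hU
    rw [hT, Finset.mem_filter, Finset.mem_powersetCard] at hU
    exact ⟨hU.1.1, hU.1.2, hU.2⟩
  have hd : ∀ U : Finset ℕ, ∃ d : ℂ, U ∈ T → (d ≠ 0 ∧
      eF n R * ((∏ u ∈ U, pairC n u : Subalgebra.center ℂ (ExtAlg n)) : ExtAlg n) =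
        d • eF n (R ∪ U.biUnion pr)) := by
    intro U
    by_cases hU : U ∈ T
    · obtain ⟨d, hd⟩ := eF_mul_prod n (hmemT U hU).2.2
      exact ⟨d, fun _ => hd⟩
    · exact ⟨0, fun h => absurd h hU⟩
  choose d hd using hd
  let g : Finset ℕ → List ℕ := fun U => (R ∪ U.biUnion pr).sort
  have hgs : ∀ U, (g U).Pairwise (· < ·) := fun U => (Finset.sortedLT_sort _).pairwise
  have hgmem : ∀ U y, y ∈ g U ↔ y ∈ R ∪ U.biUnion pr := fun U y => Finset.mem_sort _
  have hmemU : ∀ U ∈ T, ∀ u, u ∈ U ↔ 2 * u + 1 ∈ g U ∧ 2 * u + 1 ∉ R := by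
    intro U hU u
    rw [hgmem, Finset.mem_union, Finset.mem_biUnion]
    constructor
    · intro hu
      have h1 : 2 * u + 1 ∈ pr u := mem_pr.2 (Or.inl rfl)
      exact ⟨Or.inr ⟨u, hu, h1⟩, Finset.disjoint_right.1 ((hmemT U hU).2.2 u hu) h1⟩
    · rintro ⟨h1 | ⟨v, hv, h1⟩, h2⟩
      · exact absurd h1 h2
      · rw [mem_pr] at h1
        have : u = v := by omega
        rwa [this]
  have hginj : Set.InjOn g T := by
    intro U hU V hV hUV
    ext u
    rw [hmemU U hU, hmemU V hV, hUV]
  have hglen : ∀ U ∈ T, (g U).length = R.card + 2 * b := by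
    intro U hU
    rw [Finset.length_sort, card_union_biUnion_pr (hmemT U hU).2.2, (hmemT U hU).2.1]
  have hFT : F ∈ T := by
    rw [hT, Finset.mem_filter, Finset.mem_powersetCard]
    refine ⟨⟨fun u hu => ?_, rfl⟩, hRdF⟩
    have hu' := mem_fullP.1 hu
    rw [Finset.mem_sdiff, Finset.mem_range]
    refine ⟨hu'.1.trans_le hm, fun h => ?_⟩
    have h1 : 2 * u + 1 ∈ pr u := mem_pr.2 (Or.inl rfl)
    exact Finset.disjoint_left.1 (mem_emptyP.1 h).2 h1 (hu'.2 h1)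
  have hgF : g F = J₁ := by
    simp only [g, hRF]
    exact toFinset_sort_eq hs
  let c : List ℕ → ℂ := fun J => b.factorial * d (Function.invFunOn g T J)
  have hcg : ∀ U ∈ T, c (g U) = b.factorial * d U := by
    intro U hU
    simp only [c]
    rw [hginj.leftInvOn_invFunOn hU]
  refine ⟨R.card + 2 * b, T.image g, c, ⟨by omega, ?_, x, ?_, ?_⟩, ?_, ?_, ?_⟩
  · intro J hJ
    obtain ⟨U, hU, rfl⟩ := Finset.mem_image.1 hJ
    refine ⟨List.isChain_iff_pairwise.2 (hgs U), fun y hy => ?_, hglen U hU⟩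
    rw [hgmem, Finset.mem_union, Finset.mem_biUnion] at hy
    rcases hy with hy | ⟨u, hu, hy⟩
    · exact Finset.mem_Icc.1 (hAIcc (Finset.mem_sdiff.1 hy).1)
    · have h1 := Finset.mem_range.1 (Finset.mem_sdiff.1 ((hmemT U hU).1 hu)).1
      rw [mem_pr] at hy
      omega
  · convert hx using 2
    omega
  · rw [hωx, sum_pow_of_mul_self_eq_zero _ (pairC_mul_self n), Finset.sum_image hginj,
      Subalgebra.coe_mul]
    have hfac : ((b.factorial : Subalgebra.center ℂ (ExtAlg n)) : ExtAlg n) =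
        algebraMap ℂ (ExtAlg n) b.factorial := by simp
    rw [hfac, ← Algebra.smul_def, mul_smul_comm, AddSubmonoidClass.coe_finsetSum, Finset.mul_sum,
      ← Finset.sum_filter_of_ne (s := Finset.powersetCard b (Finset.range n \ E))
        (p := fun U => ∀ u ∈ U, Disjoint R (pr u)), Finset.smul_sum]
    · refine Finset.sum_congr rfl fun U hU => ?_
      rw [hcg U hU, (hd U hU).2, mul_smul]
      rfl
    · intro U _ hne u hu
      by_contra h
      exact hne (eF_mul_prod_eq_zero n hu h)
  · intro J hJ
    obtain ⟨U, hU, rfl⟩ := Finset.mem_image.1 hJ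
    rw [hcg U hU]
    exact mul_ne_zero (by exact_mod_cast b.factorial_ne_zero) (hd U hU).1
  · exact Finset.mem_image.2 ⟨F, hFT, hgF⟩
  · intro J hJ hne
    obtain ⟨U, hU, rfl⟩ := Finset.mem_image.1 hJ
    have hUF : U ≠ F := by
      rintro rfl
      exact hne hgF
    obtain ⟨hUs, hUc, hUd⟩ := hmemT U hU
    have hdiff : (F \ U).Nonempty := by
      rw [Finset.sdiff_nonempty]
      intro hsub
      exact hUF (Finset.eq_of_subset_of_card_le hsub hUc.le).symm
    obtain ⟨u₀, hu₀, hmin⟩ := (F \ U).exists_min_image id hdiff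
    rw [Finset.mem_sdiff] at hu₀
    have hu₀m := (mem_fullP.1 hu₀.1).1
    have hu₀' := (hmemU F hFT u₀).1 hu₀.1
    have hlow : ∀ u < u₀, u ∈ F → u ∈ U := by
      intro u hu huF
      by_contra h
      have := hmin u (Finset.mem_sdiff.2 ⟨huF, h⟩)
      simp only [id] at this
      omega
    rw [← hgF]
    refine lex_of_first_difference ((hglen F hFT).trans (hglen U hU).symm) (hgs F) (hgs U)
      (t := 2 * u₀ + 1) hu₀'.1 (fun h => hu₀.2 ((hmemU U hU u₀).2 ⟨h, hu₀'.2⟩)) ?_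
    intro y hy
    rw [hgmem, hgmem, Finset.mem_union, Finset.mem_union, Finset.mem_biUnion, Finset.mem_biUnion]
    refine or_congr_right ⟨?_, ?_⟩
    · rintro ⟨u, hu, hyu⟩
      refine ⟨u, hlow u ?_ hu, hyu⟩
      rw [mem_pr] at hyu
      omega
    · rintro ⟨u, hu, hyu⟩
      have huu : u < u₀ := by
        have : u ≠ u₀ := by
          rintro rfl
          exact hu₀.2 hu
        rw [mem_pr] at hyu
        omega
      refine ⟨u, ?_, hyu⟩
      have h1 : ¬ Disjoint (pr u) A := fun h =>
        (Finset.mem_sdiff.1 (hUs hu)).2 (mem_emptyP.2 ⟨huu.trans hu₀m, h⟩)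
      obtain ⟨z, hz, hzA⟩ := Finset.not_disjoint_iff.1 h1
      rw [← hRF, Finset.mem_union, Finset.mem_biUnion] at hzA
      rcases hzA with hzR | ⟨v, hv, hzv⟩
      · exact absurd hz (Finset.disjoint_left.1 (hUd u hu) hzR)
      · rw [mem_pr_iff] at hz hzv
        rwa [hz.2, ← hzv.2]

/-- Lemma `Spstratightening`. If `∑_{J ∈ S} c J • e_J` is an ω-sum of
`Sp_{2n}` with all coefficients nonzero, then its lexicographically smallest term `J₁`
satisfies `J₁ ⋡ J̃`. Conversely, every `J₁ ∈ L(2n,2n)` with `J₁ ⋡ J̃` is the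
lexicographically smallest term (with nonzero coefficient) of some ω-sum of `Sp_{2n}`. -/
theorem omega_sum_lex_minimal_characterization (n : ℕ) (hn : 0 < n) :
    (∀ (p : ℕ) (S : Finset (List ℕ)) (c : List ℕ → ℂ),
      isOmegaSum n p S c → (∀ J ∈ S, c J ≠ 0) →
      ∀ J₁ ∈ S, (∀ J ∈ S, J ≠ J₁ → List.Lex (· < ·) J₁ J) → ¬ Jtilde n J₁) ∧
    ∀ J₁ : List ℕ, J₁ ≠ [] → J₁.Chain' (· < ·) → (∀ x ∈ J₁, 1 ≤ x ∧ x ≤ 2 * n) →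
      ¬ Jtilde n J₁ →
      ∃ (p : ℕ) (S : Finset (List ℕ)) (c : List ℕ → ℂ),
        isOmegaSum n p S c ∧ (∀ J ∈ S, c J ≠ 0) ∧ J₁ ∈ S ∧
          ∀ J ∈ S, J ≠ J₁ → List.Lex (· < ·) J₁ J := by
  refine ⟨fun p S c h hc J₁ hJ₁ hmin => not_Jtilde_of_isOmegaSum h hc hJ₁ hmin, ?_⟩
  intro J₁ _ hs hb hJ
  exact exists_isOmegaSum (List.isChain_iff_pairwise.1 hs) hb hJ

end
end
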